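/- arXiv:2603.14234 — 2 statements merged into one kernel-verified Lean document; each statement's English description precedes it below -/
import Mathlib

section
/- Let Ξ_3(m) = ∑_{x ∈ (ℤ/32mℤ)ˣ} χ(x)·ψ_3(x)·S(x/(32m)) ∈ ℚ₂(ζ_8), where χ and ψ_3 are evaluated on x via reduction modulo m and modulo 32 respectively. Then v(Ξ_3(m)) = 5/4. -/
/-- The sequence `q_n`: `q_1 = 1`, `q_n = (2^n + 7)/3` for odd `n ≥ 3`, and
`q_n = (2^n − 1)/3` for even `n`. -/
def qseq (n : ℕ) : ℕ :=
  if n = 1 then 1 else if Odd n then (2 ^ n + 7) / 3 else (2 ^ n - 1) / 3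

/-- The valuation `v` on a finite extension `K` of `ℚ₂`, normalized so that `v(2) = 1`:
`v(x) = v₂(N_{K/ℚ₂}(x))/[K : ℚ₂]`. -/
noncomputable def vK {K : Type*} [Field K] [Algebra ℚ_[2] K] (x : K) : ℚ :=
  ((Algebra.norm ℚ_[2] x).valuation : ℚ) / (Module.finrank ℚ_[2] K : ℚ)

/-- The cyclotomic specialization `Ξ_n = ∑_{k ∈ (ℤ/2^{n+2}ℤ)ˣ} ψ_n(k)·S(k/2^{n+2})`. -/
noncomputable def XiN (S : ℚ → ℚ) {K : Type*} [Field K] (n : ℕ)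
    (ψ : (ZMod (2 ^ (n + 2)))ˣ →* K) : K :=
  ∑ k : (ZMod (2 ^ (n + 2)))ˣ,
    ψ k * (S (((k : ZMod (2 ^ (n + 2))).val : ℚ) / (2 ^ (n + 2) : ℚ)) : K)

/-- The twisted cyclotomic specialization
`Ξ_n(m) = ∑_{x ∈ (ℤ/2^{n+2}mℤ)ˣ} χ(x)·ψ_n(x)·S(x/(2^{n+2}m))`, where `χ = (·|m)` is the
Jacobi symbol and `ψ_n` is evaluated via reduction modulo `2^{n+2}`. -/
noncomputable def XiM (S : ℚ → ℚ) {K : Type*} [Field K] (n m : ℕ)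
    [NeZero (2 ^ (n + 2) * m)] (ψ : (ZMod (2 ^ (n + 2)))ˣ →* K) : K :=
  ∑ x : (ZMod (2 ^ (n + 2) * m))ˣ,
    ((jacobiSym ((x : ZMod (2 ^ (n + 2) * m)).val : ℤ) m : ℤ) : K) *
      ψ (Units.map
          (ZMod.castHom (dvd_mul_right (2 ^ (n + 2)) m) (ZMod (2 ^ (n + 2)))).toMonoidHom x) *
      (S (((x : ZMod (2 ^ (n + 2) * m)).val : ℚ) / ((2 ^ (n + 2) * m : ℕ) : ℚ)) : K)


section aux
open Finset
variable {K : Type*} [Field K]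

lemma sum_range_fiber (n k : ℕ) (f : ℕ → K) :
    ∑ x ∈ range (n * k), f x = ∑ y ∈ range n, ∑ j ∈ range k, f (y + n * j) := by
  induction k with
  | zero => simp
  | succ k ih =>
    rw [Nat.mul_succ, Finset.sum_range_add, ih, ← Finset.sum_add_distrib]
    refine Finset.sum_congr rfl fun y _ => ?_
    rw [Finset.sum_range_succ, add_comm (n * k) y]

lemma sum_range_zmod (n : ℕ) [NeZero n] (F : ZMod n → K) :
    ∑ x ∈ range n, F ((x : ℤ) : ZMod n) = ∑ z : ZMod n, F z := by
  refine Finset.sum_nbij' (fun x => ((x : ℤ) : ZMod n)) (fun z => z.val) ?_ ?_ ?_ ?_ ?_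
  · intro _ _; simp
  · intro z _; simpa using ZMod.val_lt z
  · intro x hx; simpa using ZMod.val_cast_of_lt (Finset.mem_range.1 hx)
  · intro z _; simp
  · intro _ _; rfl

lemma sum_range_unit (n : ℕ) (hn : 0 < n) (f : ℤ → K)
    (hf : ∀ x y : ℤ, x ≡ y [ZMOD n] → f x = f y) (c : ℤ) (hc : IsUnit (c : ZMod n)) :
    ∑ x ∈ range n, f (c * x) = ∑ x ∈ range n, f x := by
  have : NeZero n := ⟨hn.ne'⟩
  obtain ⟨u, hu⟩ := hc
  have key : ∀ x : ℤ, f x = (fun z : ZMod n => f (z.val : ℤ)) (x : ZMod n) := by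
    intro x
    apply hf
    rw [← ZMod.intCast_eq_intCast_iff]
    simp
  have h1 := sum_range_zmod n (fun z : ZMod n => f (z.val : ℤ))
  have h2 := sum_range_zmod n (fun z : ZMod n => f ((u * z : ZMod n).val : ℤ))
  have h3 : ∑ z : ZMod n, f ((u * z : ZMod n).val : ℤ) = ∑ z : ZMod n, f (z.val : ℤ) :=
    Fintype.sum_equiv (Units.mulLeft u) _ _ (fun z => rfl)
  rw [h3, ← h1] at h2
  calc _ = _ := Finset.sum_congr rfl fun x _ => by rw [key]; push_cast; rw [← hu]
    _ = _ := h2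
    _ = _ := Finset.sum_congr rfl fun x _ => (key x).symm

lemma sum_range_dvd (n l : ℕ) (hl : 0 < l) (h : ℕ → K) :
    ∑ x ∈ range (n * l), (if (l : ℤ) ∣ (x : ℤ) then h x else 0) = ∑ y ∈ range n, h (l * y) := by
  rw [mul_comm n l, sum_range_fiber, Finset.sum_comm]
  refine Finset.sum_congr rfl fun y _ => ?_
  rw [Finset.sum_eq_single_of_mem 0 (Finset.mem_range.2 hl)]
  · simp
  · intro i hi hi0
    rw [if_neg]
    rw [Int.natCast_dvd_natCast, Nat.dvd_add_left (dvd_mul_right l y)]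
    intro hd
    exact absurd (Nat.le_of_dvd (Nat.pos_of_ne_zero hi0) hd) (by simpa using hi)

lemma s_periodic (s : ℚ → K) (hper : ∀ β, s (β + 1) = s β) (n : ℕ) (hn : 0 < n)
    (x y : ℤ) (h : x ≡ y [ZMOD n]) : s ((x : ℚ) / n) = s ((y : ℚ) / n) := by
  have hp : Function.Periodic s 1 := hper
  obtain ⟨t, ht⟩ := h.dvd
  have : (y : ℚ) / n = (x : ℚ) / n + t * 1 := by
    have hn' : (n : ℚ) ≠ 0 := by positivity
    have : (y : ℚ) = x + n * t := by
      have : y = x + n * t := by linarith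
      exact_mod_cast this
    rw [this]; field_simp
  rw [this]
  exact ((hp.int_mul t) _).symm

lemma hecke_step (s : ℚ → K) (hper : ∀ β, s (β + 1) = s β) (n l : ℕ) (hn : 0 < n)
    (hl : 0 < l) (hco : Nat.Coprime l n) (A C : K)
    (hH : ∀ y : ℕ, ∑ j ∈ range l, s (((y : ℚ) / n + j) / l) =
      A * s ((y : ℚ) / n) - s (l * ((y : ℚ) / n)) + C)
    (g : ℤ → K) (hg : ∀ x y : ℤ, x ≡ y [ZMOD n] → g x = g y)
    (c : K) (hc : c ≠ 0) (hgc : ∀ y, g (l * y) = c * g y) (hg0 : ∑ x ∈ range n, g x = 0) :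
    ∑ x ∈ range (n * l), (if (l : ℤ) ∣ (x : ℤ) then 0 else g x) * s ((x : ℚ) / ((n * l : ℕ) : ℚ)) =
      (A - c - c⁻¹) * ∑ x ∈ range n, g x * s ((x : ℚ) / n) ∧
    ∑ x ∈ range (n * l), (if (l : ℤ) ∣ (x : ℤ) then 0 else g x) = 0 := by
  have hn' : (n : ℚ) ≠ 0 := by positivity
  have hl' : (l : ℚ) ≠ 0 := by positivity
  have gshift : ∀ y j : ℕ, g ((y + n * j : ℕ) : ℤ) = g y := by
    intro y j
    apply hg
    push_cast
    exact (Int.emod_emod_of_dvd _ (dvd_refl _)).symm.trans (by simp)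
  constructor
  · have e1 : ∀ x : ℕ, (if (l : ℤ) ∣ (x : ℤ) then 0 else g x) * s ((x : ℚ) / ((n * l : ℕ) : ℚ)) =
        g x * s ((x : ℚ) / ((n * l : ℕ) : ℚ)) -
          (if (l : ℤ) ∣ (x : ℤ) then g x * s ((x : ℚ) / ((n * l : ℕ) : ℚ)) else 0) := by
      intro x; split_ifs <;> simp
    simp_rw [e1]
    rw [Finset.sum_sub_distrib,
      sum_range_dvd n l hl (fun x => g x * s ((x : ℚ) / ((n * l : ℕ) : ℚ))), sum_range_fiber]
    have e2 : ∀ y ∈ range n, ∑ j ∈ range l, g ((y + n * j : ℕ) : ℤ) *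
        s (((y + n * j : ℕ) : ℚ) / ((n * l : ℕ) : ℚ)) =
        A * (g y * s ((y : ℚ) / n)) - c⁻¹ * (g (l * y) * s (((l * y : ℤ) : ℚ) / n)) + g y * C := by
      intro y _
      have : ∀ j ∈ range l, g ((y + n * j : ℕ) : ℤ) *
        s (((y + n * j : ℕ) : ℚ) / ((n * l : ℕ) : ℚ)) = g y * s (((y : ℚ) / n + j) / l) := by
        intro j _
        rw [gshift]
        congr 2
        push_cast; field_simp
      rw [Finset.sum_congr rfl this, ← Finset.mul_sum, hH, hgc]
      have : (((l * y : ℤ) : ℚ) / n) = l * ((y : ℚ) / n) := by push_cast; field_simp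
      rw [this]
      field_simp
    rw [Finset.sum_congr rfl e2, Finset.sum_add_distrib, Finset.sum_sub_distrib, ← Finset.mul_sum,
      ← Finset.mul_sum, ← Finset.sum_mul, hg0]
    have e3 := sum_range_unit n hn (fun x => g x * s ((x : ℚ) / n))
      (fun x y h => by simp only [hg x y h, s_periodic s hper n hn x y h]) l
      (by simpa using (ZMod.isUnit_iff_coprime l n).2 hco)
    simp only [Int.cast_natCast] at e3
    rw [e3]
    have e4 : ∀ y ∈ range n, g ((l * y : ℕ) : ℤ) * s (((l * y : ℕ) : ℚ) / ((n * l : ℕ) : ℚ)) =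
        c * (g y * s ((y : ℚ) / n)) := by
      intro y _
      push_cast
      rw [hgc, mul_assoc]
      congr 3
      field_simp
    rw [Finset.sum_congr rfl e4, ← Finset.mul_sum]
    ring
  · have e1 : ∀ x : ℕ, (if (l : ℤ) ∣ (x : ℤ) then 0 else g x) =
        g x - (if (l : ℤ) ∣ (x : ℤ) then g x else 0) := by
      intro x; split_ifs <;> simp
    simp_rw [e1]
    rw [Finset.sum_sub_distrib, sum_range_dvd n l hl (fun x => g x), sum_range_fiber]
    simp_rw [gshift]
    rw [Finset.sum_comm]
    push_cast
    simp [hgc, ← Finset.mul_sum, hg0]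
end aux

section normpart
open Polynomial

lemma padic_integral (x : ℚ_[2]) (h : IsIntegral ℤ x) : ‖x‖ ≤ 1 := by
  have h2 : IsIntegral ℤ_[2] x := h.tower_top
  obtain ⟨y, hy⟩ := IsIntegrallyClosed.isIntegral_iff.1 h2
  rw [← hy]
  exact y.2

variable {K : Type*} [Field K] [Algebra ℚ_[2] K] [FiniteDimensional ℚ_[2] K]

lemma norm_unit (z k : K) (hz : IsIntegral ℤ z) (hk : IsIntegral ℤ k) (u : ℤ) (hu : Odd u)
    (h : z * k = u) : (Algebra.norm ℚ_[2] z) ≠ 0 ∧ (Algebra.norm ℚ_[2] z).valuation = 0 := by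
  have h1 := padic_integral _ (Algebra.isIntegral_norm ℚ_[2] hz)
  have h2 := padic_integral _ (Algebra.isIntegral_norm ℚ_[2] hk)
  have h3 : Algebra.norm ℚ_[2] z * Algebra.norm ℚ_[2] k = (u : ℚ_[2]) ^ Module.finrank ℚ_[2] K := by
    rw [← map_mul, h, ← Algebra.norm_algebraMap]
    simp
  have hu0 : ¬ (2 : ℤ) ∣ u := by
    rw [← even_iff_two_dvd]; exact Int.not_even_iff_odd.2 hu
  have h4 : ‖(u : ℚ_[2])‖ = 1 := by
    apply le_antisymm (Padic.norm_int_le_one u)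
    by_contra hc
    exact hu0 (by exact_mod_cast (Padic.norm_intCast_lt_one_iff (p := 2) (k := u)).1 (not_le.1 hc))
  have h5 : ‖Algebra.norm ℚ_[2] z‖ * ‖Algebra.norm ℚ_[2] k‖ = 1 := by
    rw [← norm_mul, h3, norm_pow, h4, one_pow]
  have h6 : ‖Algebra.norm ℚ_[2] z‖ = 1 := by
    nlinarith [norm_nonneg (Algebra.norm ℚ_[2] z), norm_nonneg (Algebra.norm ℚ_[2] k)]
  have h0 : Algebra.norm ℚ_[2] z ≠ 0 := by
    intro h0; rw [h0] at h6; simp at h6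
  refine ⟨h0, ?_⟩
  have h7 := Padic.norm_eq_zpow_neg_valuation h0
  rw [h6] at h7
  have h8 : (2 : ℝ) ^ (-(Algebra.norm ℚ_[2] z).valuation) = 1 := by exact_mod_cast h7.symm
  have := (zpow_eq_one_iff_right₀ (by norm_num : (0 : ℝ) ≤ 2) (by norm_num)).1 h8
  omega

lemma odd_multiple (t : K) (ht : IsIntegral ℤ t) :
    ∃ k : K, IsIntegral ℤ k ∧ ∃ u : ℤ, Odd u ∧ (1 - 2 * t) * k = u := by
  obtain ⟨g, hg, hgt⟩ := ht
  set h := scaleRoots g 2 with hh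
  have h1 : aeval (2 * t) h = 0 := by
    have := scaleRoots_aeval_eq_zero (p := g) (a := t) (r := (2 : ℤ)) hgt
    simpa using this
  obtain ⟨r, hr⟩ : (X - C 1) ∣ h - C (h.eval 1) := X_sub_C_dvd_sub_C_eval
  refine ⟨aeval (2 * t) r, ?_, h.eval 1, ?_, ?_⟩
  · have ht : IsIntegral ℤ t := ⟨g, hg, hgt⟩
    have h2t : 2 * t ∈ integralClosure ℤ K := by
      have : (2 : K) ∈ integralClosure ℤ K := by
        simpa using (integralClosure ℤ K).natCast_mem 2
      exact mul_mem this ht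
    have := (aeval (⟨2 * t, h2t⟩ : integralClosure ℤ K) r).2
    have e : ((aeval (⟨2 * t, h2t⟩ : integralClosure ℤ K) r : integralClosure ℤ K) : K)
      = aeval (2 * t) r := by
      have := (Polynomial.aeval_algHom_apply (integralClosure ℤ K).val
        (⟨2 * t, h2t⟩ : integralClosure ℤ K) r)
      simpa using this.symm
    rw [e] at this
    exact this
  · rw [eval_eq_sum_range, hh, natDegree_scaleRoots, Finset.sum_range_succ]
    simp only [one_pow, mul_one, coeff_scaleRoots, Nat.sub_self, pow_zero, hg.coeff_natDegree]
    refine Even.add_one ?_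
    rw [even_iff_two_dvd]
    refine Finset.dvd_sum fun i hi => ?_
    have : g.natDegree - i ≠ 0 := by have := Finset.mem_range.1 hi; omega
    exact Dvd.dvd.mul_left (dvd_pow_self 2 this) _
  · have := congrArg (aeval (2 * t)) hr
    simp only [map_sub, map_mul, h1, aeval_X, aeval_C, map_one] at this
    simp only [eq_intCast, Int.cast_one] at this
    linear_combination this

lemma vK_final (ζ w : K) (hζ : ζ ^ 4 = -1) (hw : IsIntegral ℤ w) :
    vK (2 * (1 + ζ) * (1 + (1 + ζ) * w)) = 5 / 4 := by
  set O := integralClosure ℤ K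
  have hζO : ζ ∈ O := by
    have : IsIntegral ℤ (ζ ^ 4) := by rw [hζ]; exact (isIntegral_one).neg
    exact this.of_pow (by norm_num)
  have two : (2 : K) ∈ O := by simpa using O.natCast_mem 2
  have three : (3 : K) ∈ O := by simpa using O.natCast_mem 3
  have one : (1 : K) ∈ O := O.one_mem
  have wO : w ∈ O := hw
  have pO : 1 + ζ ∈ O := add_mem one hζO
  -- the unit factor
  set y := (1 + ζ) * w with hy
  have yO : y ∈ O := mul_mem pO wO
  have zO := pow_mem hζO
  obtain ⟨k, hk, u, hu, hku⟩ := odd_multiple (ζ ^ 2 * (3 + 2 * (ζ - ζ ^ 3)) * w ^ 4)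
    (mul_mem (mul_mem (zO 2) (add_mem three (mul_mem two (sub_mem hζO (zO 3))))) (pow_mem wO 4))
  have yy : y ^ 4 = 2 * (ζ ^ 2 * (3 + 2 * (ζ - ζ ^ 3)) * w ^ 4) := by
    rw [hy, mul_pow]; linear_combination (w ^ 4 + 4 * ζ * w ^ 4) * hζ
  obtain ⟨n1, v1⟩ := norm_unit (1 + y) ((1 - y + y ^ 2 - y ^ 3) * k) (add_mem one yO)
    (mul_mem (sub_mem (add_mem (sub_mem one yO) (pow_mem yO 2)) (pow_mem yO 3)) hk) u hu
    (by rw [← hku, ← yy]; ring)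
  obtain ⟨n2, v2⟩ := norm_unit (ζ ^ 2 * (3 + 2 * (ζ - ζ ^ 3))) (-ζ ^ 2 * (3 - 2 * (ζ - ζ ^ 3)))
    (mul_mem (zO 2) (add_mem three (mul_mem two (sub_mem hζO (zO 3)))))
    (mul_mem (neg_mem (zO 2)) (sub_mem three (mul_mem two (sub_mem hζO (zO 3))))) 1 odd_one
    (by push_cast; linear_combination (4 * ζ ^ 6 - 8 * ζ ^ 4 - 1) * hζ)
  have hd : 0 < Module.finrank ℚ_[2] K := Module.finrank_pos
  have N2 : Algebra.norm ℚ_[2] (2 : K) = (2 : ℚ_[2]) ^ Module.finrank ℚ_[2] K := by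
    rw [← Algebra.norm_algebraMap, map_ofNat (algebraMap ℚ_[2] K)]
  have n20 : (2 : ℚ_[2]) ≠ 0 := two_ne_zero
  have N20 : Algebra.norm ℚ_[2] (2 : K) ≠ 0 := by rw [N2]; exact pow_ne_zero _ n20
  have V2 : (Algebra.norm ℚ_[2] (2 : K)).valuation = Module.finrank ℚ_[2] K := by
    have h2 : (2 : ℚ_[2]).valuation = 1 := by exact_mod_cast (Padic.valuation_p (p := 2))
    rw [N2, Padic.valuation_pow, h2, mul_one]
  have p4 : (1 + ζ) ^ 4 = 2 * (ζ ^ 2 * (3 + 2 * (ζ - ζ ^ 3))) := by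
    linear_combination (1 + 4 * ζ) * hζ
  have P4 := congrArg (Algebra.norm ℚ_[2]) p4
  rw [map_pow, map_mul] at P4
  have nP : Algebra.norm ℚ_[2] (1 + ζ) ≠ 0 := by
    intro h0; rw [h0] at P4
    exact mul_ne_zero N20 n2 (by rw [← P4]; norm_num)
  have VP : 4 * (Algebra.norm ℚ_[2] (1 + ζ)).valuation = Module.finrank ℚ_[2] K := by
    have := congrArg Padic.valuation P4
    rw [Padic.valuation_pow, Padic.valuation_mul N20 n2, V2, v2] at this
    simpa using this
  unfold vK
  rw [map_mul, map_mul, Padic.valuation_mul (mul_ne_zero N20 nP) n1, Padic.valuation_mul N20 nP,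
    V2, v1]
  have VPQ : (4 : ℚ) * (Algebra.norm ℚ_[2] (1 + ζ)).valuation = Module.finrank ℚ_[2] K := by
    exact_mod_cast VP
  have hdQ : (Module.finrank ℚ_[2] K : ℚ) ≠ 0 := by positivity
  rw [div_eq_div_iff hdQ (by norm_num)]
  push_cast
  linarith
end normpart

section psipart
open Finset
variable {K : Type*} [Field K]

/-- The extension by zero to all integers of an even character mod `32` sending `5` to `ζ`. -/
structure PsiLike (f : ℤ → K) (ζ : K) : Prop where
  per : ∀ x y : ℤ, x ≡ y [ZMOD 32] → f x = f y
  mul : ∀ x y : ℤ, f (x * y) = f x * f y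
  neg_one : f (-1) = 1
  five : f 5 = ζ
  even : ∀ x : ℤ, Even x → f x = 0
  root : ζ ^ 4 = -1

lemma exists_psiLike (ζ : K) (hζ : ζ ^ 4 = -1) (ψ : (ZMod (2 ^ (3 + 2)))ˣ →* K)
    (hψneg : ∀ u : (ZMod (2 ^ (3 + 2)))ˣ, (u : ZMod (2 ^ (3 + 2))) = -1 → ψ u = 1)
    (hψ5 : ∀ u : (ZMod (2 ^ (3 + 2)))ˣ, (u : ZMod (2 ^ (3 + 2))) = 5 → ψ u = ζ) :
    ∃ f : ℤ → K, PsiLike f ζ ∧ ∀ (x : ℤ) (u : (ZMod (2 ^ (3 + 2)))ˣ),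
      (x : ZMod (2 ^ (3 + 2))) = u → f x = ψ u := by
  classical
  let f : ℤ → K := fun x => if h : IsUnit (x : ZMod (2 ^ (3 + 2))) then ψ h.unit else 0
  have hf : ∀ (x : ℤ) (u : (ZMod (2 ^ (3 + 2)))ˣ), (x : ZMod (2 ^ (3 + 2))) = u → f x = ψ u := by
    intro x u hu
    have h : IsUnit (x : ZMod (2 ^ (3 + 2))) := ⟨u, hu.symm⟩
    simp only [f, dif_pos h]
    congr 1
    ext
    simpa using hu
  have hf0 : ∀ (x : ℤ), ¬ IsUnit (x : ZMod (2 ^ (3 + 2))) → f x = 0 := by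
    intro x hx
    simp only [f, dif_neg hx]
  refine ⟨f, ⟨?_, ?_, ?_, ?_, ?_, hζ⟩, hf⟩
  · intro x y h
    have : (x : ZMod (2 ^ (3 + 2))) = y := (ZMod.intCast_eq_intCast_iff x y (2 ^ (3 + 2))).2 h
    simp only [f, this]
  · intro x y
    by_cases hx : IsUnit (x : ZMod (2 ^ (3 + 2)))
    · by_cases hy : IsUnit (y : ZMod (2 ^ (3 + 2)))
      · rw [hf (x * y) (hx.unit * hy.unit) (by simp), hf x hx.unit (by simp),
          hf y hy.unit (by simp), map_mul]
      · rw [hf0 y hy, mul_zero, hf0]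
        push_cast
        exact fun h => hy (isUnit_of_mul_isUnit_right h)
    · rw [hf0 x hx, zero_mul, hf0]
      push_cast
      exact fun h => hx (isUnit_of_mul_isUnit_left h)
  · rw [hf (-1) (-1) (by simp)]
    exact hψneg _ (by simp)
  · have h5 : IsUnit (5 : ZMod (2 ^ (3 + 2))) := IsUnit.of_mul_eq_one 13 (by decide)
    rw [hf 5 h5.unit (by simp)]
    exact hψ5 _ (by simp)
  · intro x hx
    apply hf0
    intro h
    obtain ⟨y, rfl⟩ := hx
    have h2 : IsUnit (2 : ZMod (2 ^ (3 + 2))) := by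
      have : ((y + y : ℤ) : ZMod (2 ^ (3 + 2))) = 2 * y := by push_cast; ring
      rw [this] at h
      exact isUnit_of_mul_isUnit_left h
    have h3 : (2 : ZMod (2 ^ (3 + 2))) ^ 5 = 0 := by decide
    have := h2.pow 5
    rw [h3] at this
    exact absurd (isUnit_zero_iff.1 this) (by decide)

namespace PsiLike
variable {f : ℤ → K} {ζ : K}

lemma neg (h : PsiLike f ζ) (x : ℤ) : f (-x) = f x := by
  rw [show -x = (-1) * x by ring, h.mul, h.neg_one, one_mul]

lemma v1 (h : PsiLike f ζ) : f 1 = 1 := by rw [← h.neg 1, h.neg_one]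
lemma v25 (h : PsiLike f ζ) : f 25 = ζ ^ 2 := by rw [show (25 : ℤ) = 5 * 5 by norm_num, h.mul, h.five]; ring
lemma v29 (h : PsiLike f ζ) : f 29 = ζ ^ 3 := by
  rw [h.per 29 (5 * 25) (by decide), h.mul, h.five, h.v25]; ring
lemma v17 (h : PsiLike f ζ) : f 17 = -1 := by
  rw [h.per 17 (5 * 29) (by decide), h.mul, h.five, h.v29]; linear_combination h.root
lemma v21 (h : PsiLike f ζ) : f 21 = -ζ := by
  rw [h.per 21 (5 * 17) (by decide), h.mul, h.five, h.v17]; ring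
lemma v9 (h : PsiLike f ζ) : f 9 = -ζ ^ 2 := by
  rw [h.per 9 (5 * 21) (by decide), h.mul, h.five, h.v21]; ring
lemma v13 (h : PsiLike f ζ) : f 13 = -ζ ^ 3 := by
  rw [h.per 13 (5 * 9) (by decide), h.mul, h.five, h.v9]; ring
lemma v31 (h : PsiLike f ζ) : f 31 = 1 := by rw [h.per 31 (-1) (by decide), h.neg_one]
lemma v27 (h : PsiLike f ζ) : f 27 = ζ := by rw [h.per 27 (-5) (by decide), h.neg, h.five]
lemma v7 (h : PsiLike f ζ) : f 7 = ζ ^ 2 := by rw [h.per 7 (-25) (by decide), h.neg, h.v25]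
lemma v3 (h : PsiLike f ζ) : f 3 = ζ ^ 3 := by rw [h.per 3 (-29) (by decide), h.neg, h.v29]
lemma v15 (h : PsiLike f ζ) : f 15 = -1 := by rw [h.per 15 (-17) (by decide), h.neg, h.v17]
lemma v11 (h : PsiLike f ζ) : f 11 = -ζ := by rw [h.per 11 (-21) (by decide), h.neg, h.v21]
lemma v23 (h : PsiLike f ζ) : f 23 = -ζ ^ 2 := by rw [h.per 23 (-9) (by decide), h.neg, h.v9]
lemma v19 (h : PsiLike f ζ) : f 19 = -ζ ^ 3 := by rw [h.per 19 (-13) (by decide), h.neg, h.v13]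

lemma ev (h : PsiLike f ζ) (x : ℕ) (hx : Even x) : f (x : ℤ) = 0 := h.even _ (by exact_mod_cast hx)

lemma sum32 (h : PsiLike f ζ) (F : ℕ → K) : ∑ x ∈ range 32, f x * F x =
    F 1 + F 31 + ζ * (F 5 + F 27) + ζ ^ 2 * (F 25 + F 7) + ζ ^ 3 * (F 29 + F 3)
    - (F 17 + F 15) - ζ * (F 21 + F 11) - ζ ^ 2 * (F 9 + F 23) - ζ ^ 3 * (F 13 + F 19) := by
  simp only [Finset.sum_range_succ, Finset.sum_range_zero]
  rw [h.ev 0 (by decide), h.ev 2 (by decide), h.ev 4 (by decide), h.ev 6 (by decide),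
    h.ev 8 (by decide), h.ev 10 (by decide), h.ev 12 (by decide), h.ev 14 (by decide),
    h.ev 16 (by decide), h.ev 18 (by decide), h.ev 20 (by decide), h.ev 22 (by decide),
    h.ev 24 (by decide), h.ev 26 (by decide), h.ev 28 (by decide), h.ev 30 (by decide)]
  push_cast
  rw [h.v1, h.v3, h.five, h.v7, h.v9, h.v11, h.v13, h.v15, h.v17, h.v19, h.v21, h.v23, h.v25,
    h.v27, h.v29, h.v31]
  ring

lemma zmem (h : PsiLike f ζ) : ζ ∈ integralClosure ℤ K := by
  have : IsIntegral ℤ (ζ ^ 4) := by rw [h.root]; exact (isIntegral_one).neg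
  exact this.of_pow (by norm_num)

/-- The approximation of `ψ` modulo `(1+ζ)^2`: it only depends on `x` modulo `8`. -/
lemma approx (h : PsiLike f ζ) (x : ℤ) : ∃ d ∈ integralClosure ℤ K,
    f x = (if x % 8 = 1 ∨ x % 8 = 7 then 1 else if x % 8 = 3 ∨ x % 8 = 5 then ζ else 0)
      + (1 + ζ) ^ 2 * d := by
  have hz := h.zmem
  have hr := h.root
  set O := integralClosure ℤ K
  have zO := pow_mem hz
  have one : (1 : K) ∈ O := O.one_mem
  have hθ : ζ - ζ ^ 2 + ζ ^ 3 ∈ O := add_mem (sub_mem hz (zO 2)) (zO 3)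
  have hx := h.per x (x % 32) (Int.mod_modEq x 32).symm
  have h8 : x % 8 = (x % 32) % 8 := by omega
  rw [hx, h8]
  have b0 : 0 ≤ x % 32 := by omega
  have b1 : x % 32 < 32 := by omega
  generalize x % 32 = r at *
  by_cases hev : Even r
  · refine ⟨0, O.zero_mem, ?_⟩
    have : r % 2 = 0 := Int.even_iff.1 hev
    rw [h.even r hev, if_neg (by omega), if_neg (by omega)]; ring
  have c0 : ∃ d ∈ O, (1 : K) = 1 + (1 + ζ) ^ 2 * d := ⟨0, O.zero_mem, by ring⟩
  have c2 : ∃ d ∈ O, ζ ^ 2 = 1 + (1 + ζ) ^ 2 * d :=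
    ⟨_, hθ, by linear_combination (-1 - ζ) * hr⟩
  have c4 : ∃ d ∈ O, (-1 : K) = 1 + (1 + ζ) ^ 2 * d :=
    ⟨_, mul_mem hθ (add_mem one (zO 2)), by
      linear_combination (-1 - ζ) * (1 + ζ ^ 2) * hr - hr⟩
  have c6 : ∃ d ∈ O, -ζ ^ 2 = 1 + (1 + ζ) ^ 2 * d :=
    ⟨_, mul_mem hθ (zO 2), by linear_combination (-1 - ζ) * ζ ^ 2 * hr - hr⟩
  have mulz : ∀ y : K, (∃ d ∈ O, y = 1 + (1 + ζ) ^ 2 * d) →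
      ∃ d ∈ O, ζ * y = ζ + (1 + ζ) ^ 2 * d := by
    rintro y ⟨d, hd, rfl⟩
    exact ⟨ζ * d, mul_mem hz hd, by ring⟩
  have c1 : ∃ d ∈ O, ζ = ζ + (1 + ζ) ^ 2 * d := ⟨0, O.zero_mem, by ring⟩
  have c3 := mulz _ c2
  have c5 := mulz _ c4
  have c7 := mulz _ c6
  rw [show ζ * ζ ^ 2 = ζ ^ 3 by ring] at c3
  rw [show ζ * -1 = -ζ by ring] at c5
  rw [show ζ * -ζ ^ 2 = -ζ ^ 3 by ring] at c7
  have hodd : r % 2 = 1 := Int.odd_iff.1 (Int.not_even_iff_odd.1 hev)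
  have cases : r = 1 ∨ r = 3 ∨ r = 5 ∨ r = 7 ∨ r = 9 ∨ r = 11 ∨ r = 13 ∨ r = 15 ∨ r = 17 ∨
    r = 19 ∨ r = 21 ∨ r = 23 ∨ r = 25 ∨ r = 27 ∨ r = 29 ∨ r = 31 := by omega
  clear hx h8 b0 b1 hev hodd
  rcases cases with rfl | rfl | rfl | rfl | rfl | rfl | rfl | rfl | rfl | rfl | rfl | rfl | rfl |
    rfl | rfl | rfl <;> norm_num [h.v1, h.v3, h.five, h.v7, h.v9, h.v11, h.v13, h.v15, h.v17,
      h.v19, h.v21, h.v23, h.v25, h.v27, h.v29, h.v31] <;>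
    first | assumption | exact ⟨0, O.zero_mem, Or.inr rfl⟩

/-- On odd integers, `ψ` is `1` modulo `1+ζ`. -/
lemma one_mod (h : PsiLike f ζ) (x : ℤ) (hx : Odd x) : ∃ d ∈ integralClosure ℤ K, f x = 1 + (1 + ζ) * d := by
  have hz := h.zmem
  have zO := pow_mem hz
  obtain ⟨d, hd, e⟩ := h.approx x
  have ho := Int.odd_iff.1 hx
  have one := (integralClosure ℤ K).one_mem
  by_cases h1 : x % 8 = 1 ∨ x % 8 = 7
  · rw [if_pos h1] at e
    exact ⟨(1 + ζ) * d, mul_mem (add_mem one hz) hd, by rw [e]; ring⟩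
  · rw [if_neg h1, if_pos (by omega)] at e
    refine ⟨(ζ - ζ ^ 2 + ζ ^ 3) + (1 + ζ) * d, add_mem (add_mem (sub_mem hz (zO 2)) (zO 3))
      (mul_mem (add_mem one hz) hd), ?_⟩
    rw [e]; linear_combination - h.root

/-- The Euler factor at an odd prime is `1` modulo `1+ζ`. -/
lemma euler (h : PsiLike f ζ) (x A : ℤ) (hx : Odd x) (hA : Odd A) : f x ≠ 0 ∧ ∃ d ∈ integralClosure ℤ K,
    (A : K) - f x - (f x)⁻¹ = 1 + (1 + ζ) * d := by
  have hz := h.zmem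
  have zO := pow_mem hz
  have one := (integralClosure ℤ K).one_mem
  have hco : IsCoprime x 32 := by
    have : IsCoprime x 2 := by
      obtain ⟨k, hk⟩ := hx
      exact ⟨1, -k, by rw [hk]; ring⟩
    simpa using this.pow_right (n := 5)
  obtain ⟨y, z, hyz⟩ := hco
  have hinv : f x * f y = 1 := by
    rw [← h.mul, ← h.v1]
    apply h.per
    rw [Int.modEq_iff_dvd]
    exact ⟨z, by linear_combination - hyz⟩
  have hfx : f x ≠ 0 := left_ne_zero_of_mul_eq_one hinv
  refine ⟨hfx, ?_⟩
  have hy : Odd y := by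
    by_contra hne
    rw [h.even y (Int.not_odd_iff_even.1 hne), mul_zero] at hinv
    exact zero_ne_one hinv
  rw [inv_eq_of_mul_eq_one_right hinv]
  obtain ⟨d, hd, e⟩ := h.one_mod x hx
  obtain ⟨d', hd', e'⟩ := h.one_mod y hy
  obtain ⟨b, rfl⟩ := hA
  refine ⟨((b : K) - 1) * (1 - ζ + ζ ^ 2 - ζ ^ 3) - d - d', ?_, ?_⟩
  · refine sub_mem (sub_mem (mul_mem (sub_mem ?_ one) ?_) hd) hd'
    · exact (integralClosure ℤ K).intCast_mem b
    · exact sub_mem (add_mem (sub_mem one hz) (zO 2)) (zO 3)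
  · rw [e, e']
    push_cast
    linear_combination ((b : K) - 1) * h.root

end PsiLike
end psipart

section fiber
open Finset
variable {K : Type*} [Field K]

lemma fiber_even {f : ℤ → K} {ζ : K} (h : PsiLike f ζ) (s : ℚ → K)
    (shalf : ∀ β, ∃ c : ℤ, 2 * s β = c) (m : ℕ) (hm : 0 < m)
    (h4 : ∀ y : ℕ, ∑ j ∈ range 4, s (((y : ℚ) / (8 * m : ℕ) + j) / 4) =
      -2 * s ((y : ℚ) / (8 * m : ℕ)) - 2)
    (α : ℤ → K) (hα : ∀ x, α x ∈ integralClosure ℤ K)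
    (hαper : ∀ x y : ℤ, x ≡ y [ZMOD m] → α x = α y) :
    ∃ e ∈ integralClosure ℤ K, ∑ x ∈ range (32 * m),
      2 * (α x * f x * s ((x : ℚ) / (32 * m : ℕ))) = (1 + ζ) ^ 2 * e := by
  have hz := h.zmem
  have sO : ∀ β, 2 * s β ∈ integralClosure ℤ K := by
    intro β
    obtain ⟨c, hc⟩ := shalf β
    rw [hc]
    exact (integralClosure ℤ K).intCast_mem c
  choose d hd hfd using h.approx
  set ω : ℤ → K := fun x =>
    if x % 8 = 1 ∨ x % 8 = 7 then 1 else if x % 8 = 3 ∨ x % 8 = 5 then ζ else 0 with hω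
  set O := integralClosure ℤ K
  have zO := pow_mem hz
  have one : (1 : K) ∈ O := O.one_mem
  have two : (2 : K) ∈ O := by simpa using O.natCast_mem 2
  have three : (3 : K) ∈ O := by simpa using O.natCast_mem 3
  have hωO : ∀ x, ω x ∈ O := by
    intro x
    simp only [hω]
    split_ifs
    · exact one
    · exact hz
    · exact O.zero_mem
  have hω8 : ∀ y j : ℕ, ω ((y + 8 * m * j : ℕ) : ℤ) = ω y := by
    intro y j
    have : ((y + 8 * m * j : ℕ) : ℤ) % 8 = (y : ℤ) % 8 := by
      push_cast
      rw [mul_assoc]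
      omega
    simp only [hω, this]
  have hα8 : ∀ y j : ℕ, α ((y + 8 * m * j : ℕ) : ℤ) = α y := by
    intro y j
    apply hαper
    apply Int.ModEq.symm
    rw [Int.modEq_iff_dvd]
    exact ⟨8 * j, by push_cast; ring⟩
  have main : ∑ x ∈ range (32 * m), α x * ω x * (2 * s ((x : ℚ) / (32 * m : ℕ))) =
      2 * ∑ y ∈ range (8 * m), α y * ω y * (-(2 * s ((y : ℚ) / (8 * m : ℕ))) - 2) := by
    rw [show 32 * m = 8 * m * 4 by ring, sum_range_fiber, Finset.mul_sum]
    refine Finset.sum_congr rfl fun y _ => ?_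
    have : ∀ j ∈ range 4, α ((y + 8 * m * j : ℕ) : ℤ) * ω ((y + 8 * m * j : ℕ) : ℤ) *
        (2 * s (((y + 8 * m * j : ℕ) : ℚ) / (8 * m * 4 : ℕ))) =
        α y * ω y * 2 * s (((y : ℚ) / (8 * m : ℕ) + j) / 4) := by
      intro j _
      rw [hω8, hα8]
      have : ((y + 8 * m * j : ℕ) : ℚ) / (8 * m * 4 : ℕ) = ((y : ℚ) / (8 * m : ℕ) + j) / 4 := by
        have : (m : ℚ) ≠ 0 := by positivity
        push_cast; field_simp
      rw [this]; ring
    rw [Finset.sum_congr rfl this, ← Finset.mul_sum, h4]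
    ring
  refine ⟨(1 + ζ) ^ 2 * (-ζ ^ 2 * (3 - 2 * (ζ - ζ ^ 3))) *
      ∑ y ∈ range (8 * m), α y * ω y * (-(2 * s ((y : ℚ) / (8 * m : ℕ))) - 2) +
      ∑ x ∈ range (32 * m), α x * d x * (2 * s ((x : ℚ) / (32 * m : ℕ))), ?_, ?_⟩
  · refine add_mem (mul_mem (mul_mem (pow_mem (add_mem one hz) 2) (mul_mem (neg_mem (zO 2))
      (sub_mem three (mul_mem two (sub_mem hz (zO 3)))))) ?_) ?_
    · exact sum_mem fun y _ => mul_mem (mul_mem (hα _) (hωO _)) (sub_mem (neg_mem (sO _)) two)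
    · exact sum_mem fun y _ => mul_mem (mul_mem (hα _) (hd _)) (sO _)
  · have h2 : (1 + ζ) ^ 2 * ((1 + ζ) ^ 2 * (-ζ ^ 2 * (3 - 2 * (ζ - ζ ^ 3)))) = 2 := by
      linear_combination ((-ζ ^ 2 * (3 - 2 * (ζ - ζ ^ 3))) * (1 + 4 * ζ)
        + 2 * (4 * ζ ^ 6 - 8 * ζ ^ 4 - 1)) * h.root
    rw [mul_add, ← mul_assoc, h2, ← main, Finset.mul_sum, ← Finset.sum_add_distrib]
    refine Finset.sum_congr rfl fun x _ => ?_
    rw [hfd x]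
    ring
end fiber

/-- `v(Ξ_3(m)) = 5/4`, where `Ξ_3(m) = ∑_{x ∈ (ℤ/32mℤ)ˣ} χ(x)·ψ_3(x)·S(x/32m)`. -/
theorem valuation_twisted_specialization_level_three
    (N : ℕ) (hN : Odd N)
    (a : ℕ → ℤ) (ha1 : a 1 = 1)
    (hamul : ∀ m k : ℕ, Nat.Coprime m k → a (m * k) = a m * a k)
    (S : ℚ → ℚ)
    (hS0 : S 0 = 0) (hSneg : ∀ β : ℚ, S (-β) = S β) (hSper : ∀ β : ℚ, S (β + 1) = S β)
    (hHecke : ∀ ℓ : ℕ, ℓ.Prime → ¬(ℓ ∣ N) → ∀ β : ℚ, Nat.Coprime β.den N →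
      ∑ x ∈ Finset.range ℓ, S ((β + (x : ℚ)) / (ℓ : ℚ)) =
        (a ℓ : ℚ) * S β - S ((ℓ : ℚ) * β) + ∑ x ∈ Finset.range ℓ, S ((x : ℚ) / (ℓ : ℚ)))
    (ha2 : a 2 = 0)
    (hhalf : ∀ β : ℚ, ∃ c : ℤ, S β = (c : ℚ) / 2)
    (hv2 : S (1 / 2) = -1) (hv4 : S (1 / 4) = -(1 / 2))
    (hv8 : ∀ x : ℤ, Odd x → S ((x : ℚ) / 8) = 0)
    (hv16a : S (1 / 16) = 0) (hv16b : S (5 / 16) = 0)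
    (hv16c : S (3 / 16) = -(1 / 2)) (hv16d : S (7 / 16) = -(1 / 2))
    (hv32a : S (3 / 32) = -(1 / 2)) (hv32b : S (7 / 32) = -(1 / 2))
    (hv32c : S (9 / 32) = -(1 / 2)) (hv32d : S (13 / 32) = -(1 / 2))
    (hv32e : S (11 / 32) = -1) (hv32f : S (15 / 32) = -1)
    (hv32g : S (1 / 32) = 0) (hv32h : S (5 / 32) = 0)
    (p q : ℕ) (hp : p.Prime) (hq : q.Prime) (hpq : p ≠ q)
    (hpN : ¬(p ∣ N)) (hqN : ¬(q ∣ N))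
    (hp12 : p % 12 = 7) (hq12 : q % 12 = 7)
    (hap : Odd (a p)) (haq : Odd (a q))
    [NeZero (2 ^ (3 + 2) * (p * q))]
    (K : Type*) [Field K] [Algebra ℚ_[2] K] [FiniteDimensional ℚ_[2] K]
    (ζ : K) (hζ : IsPrimitiveRoot ζ 8)
    (ψ : (ZMod (2 ^ (3 + 2)))ˣ →* K)
    (hψneg : ∀ u : (ZMod (2 ^ (3 + 2)))ˣ, (u : ZMod (2 ^ (3 + 2))) = -1 → ψ u = 1)
    (hψ5 : ∀ u : (ZMod (2 ^ (3 + 2)))ˣ, (u : ZMod (2 ^ (3 + 2))) = 5 → ψ u = ζ) :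
    vK (XiM S 3 (p * q) ψ) = 5 / 4 := by
  have hK : CharZero K := charZero_of_injective_algebraMap (algebraMap ℚ_[2] K).injective
  have hroot : ζ ^ 4 = -1 := by
    have h8 := hζ.pow_eq_one
    have h4 : ζ ^ 4 ≠ 1 := hζ.pow_ne_one_of_pos_of_lt (by norm_num) (by norm_num)
    have : (ζ ^ 4 - 1) * (ζ ^ 4 + 1) = 0 := by linear_combination h8
    rcases mul_eq_zero.1 this with h | h
    · exact absurd (sub_eq_zero.1 h) h4
    · linear_combination h
  obtain ⟨f, hf, hfψ⟩ := exists_psiLike ζ hroot ψ hψneg hψ5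
  have hp2 : p % 4 = 3 := by omega
  have hq2 : q % 4 = 3 := by omega
  have hpo : Odd p := Nat.odd_iff.2 (by omega)
  have hqo : Odd q := Nat.odd_iff.2 (by omega)
  have hpN' : Nat.Coprime p N := (Nat.Prime.coprime_iff_not_dvd hp).2 hpN
  have hqN' : Nat.Coprime q N := (Nat.Prime.coprime_iff_not_dvd hq).2 hqN
  have h2N : Nat.Coprime 2 N := hN.coprime_two_left
  have h2N' : ¬ 2 ∣ N := fun h => by
    have := Nat.odd_iff.1 hN; omega
  have hden : ∀ (y n : ℕ), Nat.Coprime n N → Nat.Coprime ((y : ℚ) / n).den N := by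
    intro y n hn
    have h1 : ((((y : ℤ) : ℚ) / ((n : ℤ) : ℚ)).den : ℤ) ∣ (n : ℤ) := by
      rw [← Rat.divInt_eq_div]; exact Rat.den_dvd y n
    exact Nat.Coprime.coprime_dvd_left (Int.natCast_dvd_natCast.1 (by simpa using h1)) hn
  have c8 : ∀ k : ℕ, Nat.Coprime (2 ^ k) N := fun k => Nat.Coprime.pow_left k h2N
  -- transfer to K
  set s : ℚ → K := fun β => (S β : K) with hs
  have sper : ∀ β, s (β + 1) = s β := fun β => by simp only [hs, hSper]
  have sneg : ∀ β, s (-β) = s β := fun β => by simp only [hs, hSneg]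
  have shalf : ∀ β, ∃ c : ℤ, 2 * s β = c := by
    intro β
    obtain ⟨c, hc⟩ := hhalf β
    refine ⟨c, ?_⟩
    simp only [hs, hc]
    push_cast
    field_simp
  have sH : ∀ ℓ : ℕ, ℓ.Prime → ¬(ℓ ∣ N) → ∀ β : ℚ, Nat.Coprime β.den N →
      ∑ x ∈ Finset.range ℓ, s ((β + (x : ℚ)) / (ℓ : ℚ)) =
        (a ℓ : K) * s β - s ((ℓ : ℚ) * β) + ∑ x ∈ Finset.range ℓ, s ((x : ℚ) / (ℓ : ℚ)) := by
    intro ℓ h1 h2 β h3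
    have := congrArg (fun r : ℚ => (r : K)) (hHecke ℓ h1 h2 β h3)
    push_cast at this
    exact this
  have s2 : ∀ (y n : ℕ), Nat.Coprime n N →
      s ((y : ℚ) / n / 2) + s (((y : ℚ) / n + 1) / 2) = - s (2 * ((y : ℚ) / n)) - 1 := by
    intro y n hn
    have := sH 2 Nat.prime_two h2N' _ (hden y n hn)
    simp only [Finset.sum_range_succ, Finset.sum_range_zero, ha2] at this
    norm_num at this
    have e0 : s 0 = 0 := by simp [hs, hS0]
    have e1 : s (1 / 2) = -1 := by simp only [hs, hv2]; norm_num
    rw [e0, e1] at this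
    rw [this]; ring
  -- the Euler factors
  obtain ⟨cp, dp, hdp, edp⟩ := hf.euler p (a p) (by exact_mod_cast hpo) hap
  obtain ⟨cq, dq, hdq, edq⟩ := hf.euler q (a q) (by exact_mod_cast hqo) haq
  have hp32 : Nat.Coprime p 32 := by
    have : Nat.Coprime p (2 ^ 5) := Nat.Coprime.pow_right 5 hpo.coprime_two_right
    simpa using this
  have hq32 : Nat.Coprime q 32 := by
    have : Nat.Coprime q (2 ^ 5) := Nat.Coprime.pow_right 5 hqo.coprime_two_right
    simpa using this
  have hqp : Nat.Coprime q p := (Nat.coprime_primes hq hp).2 hpq.symm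
  have f0 : ∑ x ∈ Finset.range 32, f x = 0 := by
    have := hf.sum32 (fun _ => 1)
    simp only [mul_one] at this
    rw [this]; ring
  have step1 := hecke_step s sper 32 p (by norm_num) hp.pos hp32 (a p)
    (∑ x ∈ Finset.range p, s ((x : ℚ) / (p : ℚ)))
    (fun y => sH p hp hpN _ (hden y 32 (c8 5))) f hf.per (f p) cp (fun y => hf.mul _ _) f0
  obtain ⟨t1, z1⟩ := step1
  have hpZ : Prime (p : ℤ) := Nat.prime_iff_prime_int.1 hp
  have hqZ : Prime (q : ℤ) := Nat.prime_iff_prime_int.1 hq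
  have hpq' : ¬ (p : ℤ) ∣ (q : ℤ) := by
    rw [Int.natCast_dvd_natCast]
    exact fun h => hpq ((Nat.prime_dvd_prime_iff_eq hp hq).1 h)
  obtain ⟨t2, -⟩ := hecke_step s sper (32 * p) q (by have := hp.pos; omega) hq.pos
    (Nat.Coprime.mul_right hq32 hqp) (a q)
    (∑ x ∈ Finset.range q, s ((x : ℚ) / (q : ℚ)))
    (fun y => sH q hq hqN _ (hden y (32 * p) (Nat.Coprime.mul_left (c8 5) hpN')))
    (fun x => if (p : ℤ) ∣ x then 0 else f x)
    (fun x y h => by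
      have h1 : x ≡ y [ZMOD p] := h.of_dvd ⟨32, by push_cast; ring⟩
      have h2 : x ≡ y [ZMOD 32] := h.of_dvd ⟨p, by push_cast; ring⟩
      simp only [hf.per x y h2, h1.dvd_iff])
    (f q) cq
    (fun y => by
      have : (p : ℤ) ∣ q * y ↔ (p : ℤ) ∣ y :=
        ⟨fun h => (hpZ.dvd_or_dvd h).resolve_left hpq', fun h => h.mul_left _⟩
      simp only [this, hf.mul]
      split_ifs <;> simp) z1
  -- the value at level 32
  have base : ∑ x ∈ Finset.range 32, f x * s ((x : ℚ) / (32 : ℕ)) = 2 * (1 + ζ) := by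
    rw [hf.sum32 (fun x => s ((x : ℚ) / (32 : ℕ)))]
    have refl : ∀ x y : ℕ, x + y = 32 → s ((x : ℚ) / (32 : ℕ)) = s ((y : ℚ) / (32 : ℕ)) := by
      intro x y h
      have : ((x : ℚ) / (32 : ℕ)) = -((y : ℚ) / (32 : ℕ)) + 1 := by
        have : (x : ℚ) = 32 - y := by
          have : (x : ℚ) + y = 32 := by exact_mod_cast h
          linarith
        rw [this]; push_cast; ring
      rw [this, sper, sneg]
    rw [refl 31 1 rfl, refl 27 5 rfl, refl 25 7 rfl, refl 29 3 rfl, refl 17 15 rfl,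
      refl 21 11 rfl, refl 23 9 rfl, refl 19 13 rfl]
    simp only [hs]
    norm_num [hv32a, hv32b, hv32c, hv32d, hv32e, hv32f, hv32g, hv32h]
    ring
  rw [base] at t1
  rw [t1] at t2
  -- the Jacobi symbols
  have hm0 : 0 < p * q := Nat.mul_pos hp.pos hq.pos
  have hp0 : NeZero p := ⟨hp.ne_zero⟩
  have hq0 : NeZero q := ⟨hq.ne_zero⟩
  let α : ℤ → K := fun x => if jacobiSym x p = 1 ∧ jacobiSym x q = -1 then 1 else 0
  have hαO : ∀ x, α x ∈ integralClosure ℤ K := by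
    intro x
    simp only [α]
    split_ifs
    · exact (integralClosure ℤ K).one_mem
    · exact (integralClosure ℤ K).zero_mem
  have hαper : ∀ x y : ℤ, x ≡ y [ZMOD ((p * q : ℕ) : ℤ)] → α x = α y := by
    intro x y h
    have h1 : x % p = y % p := h.of_dvd ⟨q, by push_cast; ring⟩
    have h2 : x % q = y % q := h.of_dvd ⟨p, by push_cast; ring⟩
    have e1 : jacobiSym x p = jacobiSym y p := jacobiSym.mod_left' h1
    have e2 : jacobiSym x q = jacobiSym y q := jacobiSym.mod_left' h2
    simp only [α, e1, e2]
  have jneg : ∀ (r : ℕ) (x : ℤ), r % 4 = 3 → jacobiSym (-x) r = - jacobiSym x r := by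
    intro r x hr
    rw [jacobiSym.neg x (Nat.odd_iff.2 (by omega)), ZMod.χ₄_nat_three_mod_four hr]; ring
  have jzero : ∀ (r : ℕ) (x : ℤ), r.Prime → (jacobiSym x r = 0 ↔ (r : ℤ) ∣ x) := by
    intro r x hr
    have : NeZero r := ⟨hr.ne_zero⟩
    have hrZ : Prime (r : ℤ) := Nat.prime_iff_prime_int.1 hr
    rw [jacobiSym.eq_zero_iff_not_coprime, ne_eq, ← Int.isCoprime_iff_gcd_eq_one, isCoprime_comm,
      hrZ.irreducible.coprime_iff_not_dvd, not_not]
  have pointwise : ∀ x : ℤ, (if (q : ℤ) ∣ x then 0 else if (p : ℤ) ∣ x then 0 else f x)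
      - (jacobiSym x (p * q) : K) * f x = 2 * α (-x) * f x + 2 * α x * f x := by
    intro x
    rw [jacobiSym.mul_right]
    simp only [α, jneg p x hp2, jneg q x hq2, ← jzero p x hp, ← jzero q x hq]
    rcases jacobiSym.trichotomy x p with h1 | h1 | h1 <;>
    rcases jacobiSym.trichotomy x q with h2 | h2 | h2 <;>
    simp only [h1, h2] <;> norm_num <;> ring
  have hn0 : 0 < 32 * p * q := Nat.mul_pos (Nat.mul_pos (by norm_num) hp.pos) hq.pos
  have flip : ∑ x ∈ Finset.range (32 * p * q), α (-(x : ℤ)) * f x * s ((x : ℚ) / (32 * p * q : ℕ))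
      = ∑ x ∈ Finset.range (32 * p * q), α x * f x * s ((x : ℚ) / (32 * p * q : ℕ)) := by
    have := sum_range_unit (32 * p * q) hn0
      (fun x => α x * f x * s ((x : ℚ) / (32 * p * q : ℕ)))
      (fun x y h => by
        have h1 := hαper x y (h.of_dvd ⟨32, by push_cast; ring⟩)
        have h2 := hf.per x y (h.of_dvd ⟨p * q, by push_cast; ring⟩)
        simp only [h1, h2, s_periodic s sper _ hn0 x y h]) (-1) (by simp)
    simp only [Int.cast_natCast] at this
    rw [← this]
    refine Finset.sum_congr rfl fun x _ => ?_
    rw [show (-1 : ℤ) * x = -x by ring, hf.neg]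
    congr 1
    push_cast
    rw [neg_div, sneg]
  obtain ⟨e, heO, he⟩ := fiber_even hf s shalf (p * q) hm0
    (fun y => by
      have h16 : Nat.Coprime (16 * (p * q)) N :=
        Nat.Coprime.mul_left (c8 4) (Nat.Coprime.mul_left hpN' hqN')
      have a1 := s2 y (16 * (p * q)) h16
      have a2 := s2 (y + 8 * (p * q)) (16 * (p * q)) h16
      have hpq0 : ((p * q : ℕ) : ℚ) ≠ 0 := by positivity
      set m := p * q
      simp only [Finset.sum_range_succ, Finset.sum_range_zero]
      have b0 : ((y : ℚ) / (8 * m : ℕ) + (0 : ℕ)) / 4 = (y : ℚ) / (16 * m : ℕ) / 2 := by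
        push_cast; field_simp; ring
      have b2 : ((y : ℚ) / (8 * m : ℕ) + (2 : ℕ)) / 4 = ((y : ℚ) / (16 * m : ℕ) + 1) / 2 := by
        push_cast; field_simp; ring
      have b1 : ((y : ℚ) / (8 * m : ℕ) + (1 : ℕ)) / 4 =
          ((y + 8 * m : ℕ) : ℚ) / (16 * m : ℕ) / 2 := by
        push_cast; field_simp; ring
      have b3 : ((y : ℚ) / (8 * m : ℕ) + (3 : ℕ)) / 4 =
          (((y + 8 * m : ℕ) : ℚ) / (16 * m : ℕ) + 1) / 2 := by
        push_cast; field_simp; ring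
      have d1 : 2 * ((y : ℚ) / (16 * m : ℕ)) = (y : ℚ) / (8 * m : ℕ) := by
        push_cast; field_simp; ring
      have d2 : 2 * (((y + 8 * m : ℕ) : ℚ) / (16 * m : ℕ)) = (y : ℚ) / (8 * m : ℕ) + 1 := by
        push_cast; field_simp; ring
      rw [d1] at a1
      rw [d2, sper] at a2
      rw [b0, b1, b2, b3]
      linear_combination a1 + a2) α hαO hαper
  have e32 : 32 * (p * q) = 32 * p * q := by ring
  rw [e32] at he
  -- the sum defining Ξ
  have hXi : XiM S 3 (p * q) ψ = ∑ x ∈ Finset.range (32 * p * q),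
      (jacobiSym (x : ℤ) (p * q) : K) * f x * s ((x : ℚ) / (32 * p * q : ℕ)) := by
    have e32' : 2 ^ (3 + 2) * (p * q) = 32 * p * q := by ring
    rw [← e32']
    unfold XiM
    refine Finset.sum_of_injOn (fun x => (x : ZMod (2 ^ (3 + 2) * (p * q))).val) ?_ ?_ ?_ ?_
    · intro x _ y _ h
      exact Units.ext (ZMod.val_injective _ h)
    · intro x _
      simpa using ZMod.val_lt (x : ZMod (2 ^ (3 + 2) * (p * q)))
    · intro x hx hne
      have hnu : ¬ Nat.Coprime x (2 ^ (3 + 2) * (p * q)) := by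
        intro hc
        apply hne
        refine ⟨ZMod.unitOfCoprime x hc, by simp, ?_⟩
        simp only [ZMod.coe_unitOfCoprime]
        exact ZMod.val_cast_of_lt (Finset.mem_range.1 hx)
      by_cases hx2 : Even x
      · rw [hf.ev x hx2]; ring
      · have hxo : Nat.Coprime x (2 ^ (3 + 2)) :=
          Nat.Coprime.pow_right _ (Nat.not_even_iff_odd.1 hx2).coprime_two_right
        have : jacobiSym (x : ℤ) (p * q) = 0 := by
          have : NeZero (p * q) := ⟨hm0.ne'⟩
          rw [jacobiSym.eq_zero_iff_not_coprime]
          intro h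
          exact hnu (Nat.Coprime.mul_right hxo (by
            rwa [Int.gcd_natCast_natCast] at h))
        rw [this]; simp
    · intro x _
      congr 2
      symm
      apply hfψ
      simp
  -- conclusion
  have key : XiM S 3 (p * q) ψ =
      2 * (1 + ζ) * (1 + (1 + ζ) * (dp + dq + (1 + ζ) * (dp * dq) - e)) := by
    have hsum : (∑ x ∈ Finset.range (32 * p * q),
        (if (q : ℤ) ∣ (x : ℤ) then 0 else if (p : ℤ) ∣ (x : ℤ) then 0 else f x) *
          s ((x : ℚ) / ((32 * p * q : ℕ) : ℚ))) - XiM S 3 (p * q) ψ = 2 * ((1 + ζ) ^ 2 * e) := by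
      rw [hXi, ← Finset.sum_sub_distrib, ← he]
      have : ∀ x ∈ Finset.range (32 * p * q),
          (if (q : ℤ) ∣ (x : ℤ) then 0 else if (p : ℤ) ∣ (x : ℤ) then 0 else f x) *
          s ((x : ℚ) / ((32 * p * q : ℕ) : ℚ)) -
          (jacobiSym (x : ℤ) (p * q) : K) * f x * s ((x : ℚ) / (32 * p * q : ℕ)) =
          2 * (α (-(x : ℤ)) * f x * s ((x : ℚ) / (32 * p * q : ℕ))) +
          2 * (α x * f x * s ((x : ℚ) / (32 * p * q : ℕ))) := by
        intro x _
        rw [← sub_mul, pointwise]; ring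
      rw [Finset.sum_congr rfl this, Finset.sum_add_distrib, ← Finset.mul_sum, ← Finset.mul_sum,
        flip, Finset.mul_sum, Finset.mul_sum, ← Finset.sum_add_distrib]
      refine Finset.sum_congr rfl fun x _ => ?_
      ring
    rw [t2, edp, edq] at hsum
    linear_combination -hsum
  rw [key]
  have hz := hf.zmem
  have pO := add_mem (integralClosure ℤ K).one_mem hz
  exact vK_final ζ _ hroot
    (sub_mem (add_mem (add_mem hdp hdq) (mul_mem pO (mul_mem hdp hdq))) heO)
end

section
/- The element Ξ_3(m) = ∑_{x ∈ (ℤ/32mℤ)ˣ} χ(x)·ψ_3(x)·S(x/(32m)) lies in ℤ[ζ_8], so there are unique integers c_1, c_2, c_3, c_4 with Ξ_3(m) = c_1ζ_8 + c_2ζ_8² + c_3ζ_8³ + c_4ζ_8⁴ (using that {ζ_8, ζ_8², ζ_8³, ζ_8⁴} is a ℤ-basis of ℤ[ζ_8]). These integers satisfy the congruences c_1 + c_4 ≡ 0 (mod 4), c_2 + c_3 ≡ 0 (mod 4), c_1 + c_2 ≡ 2 (mod 4), and c_3 + c_4 ≡ 2 (mod 4). -/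
section Helpers
open Finset

lemma aux_val {α : Type*} (M : ℕ) [NeZero M] (P : ℤ → α) (hP : ∀ n, P (n + M) = P n) (n : ℤ) :
    P (((n : ZMod M).val : ℕ) : ℤ) = P n := by
  rw [ZMod.val_intCast]
  have h : Function.Periodic P (M : ℤ) := hP
  have := h.int_mul (n / M) (n % M)
  rw [← this]
  congr 1
  simp only [Int.cast_id]
  rw [mul_comm]; exact Int.emod_add_mul_ediv n M

lemma aux_zsum {α : Type*} [AddCommMonoid α] (M : ℕ) [NeZero M] (P : ℤ → α) :
    ∑ i ∈ range M, P i = ∑ x : ZMod M, P (x.val : ℤ) := by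
  symm
  refine Finset.sum_bij (fun x _ => x.val) ?_ ?_ ?_ ?_
  · intro x _; simpa using ZMod.val_lt x
  · intro x _ y _ h; exact ZMod.val_injective M h
  · intro b hb; exact ⟨(b : ZMod M), by simp, ZMod.val_cast_of_lt (by simpa using hb)⟩
  · intros; rfl

lemma aux_perm {α : Type*} [AddCommMonoid α] (M : ℕ) [NeZero M] (P : ℤ → α) (hP : ∀ n, P (n + M) = P n) (u j : ℤ)
    (hu : IsCoprime u (M : ℤ)) :
    ∑ i ∈ range M, P (u * i + j) = ∑ i ∈ range M, P i := by
  rw [aux_zsum M P, aux_zsum M (fun i => P (u * i + j))]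
  obtain ⟨b, c, hbc⟩ := hu
  have hU : (b : ZMod M) * u = 1 := by
    have := congrArg (Int.cast : ℤ → ZMod M) hbc
    push_cast at this
    simpa using this
  refine Fintype.sum_bijective (fun x : ZMod M => (u : ZMod M) * x + j) ?_ _ _ ?_
  · apply Function.Injective.bijective_of_finite
    intro x y h
    have h2 : (u : ZMod M) * x = u * y := by simpa using h
    calc x = b * u * x := by rw [hU, one_mul]
      _ = b * u * y := by rw [mul_assoc, h2, mul_assoc]
      _ = y := by rw [hU, one_mul]
  · intro x
    rw [← aux_val M P hP (u * x.val + j)]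
    simp

lemma aux_mul {α : Type*} [AddCommMonoid α] (M p : ℕ) (P : ℤ → α) :
    ∑ i ∈ range (M * p), P i = ∑ i ∈ range M, ∑ j ∈ range p, P (p * i + j) := by
  induction M with
  | zero => simp
  | succ M ih =>
    rw [add_mul, one_mul, Finset.sum_range_add, ih, Finset.sum_range_succ]
    congr 1
    apply Finset.sum_congr rfl; intro j _; congr 1; push_cast; ring

lemma aux_mul' {α : Type*} [AddCommMonoid α] (M p : ℕ) (P : ℤ → α) :
    ∑ i ∈ range (M * p), P i = ∑ j ∈ range p, ∑ i ∈ range M, P (p * i + j) := by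
  rw [aux_mul, Finset.sum_comm]

/-- symmetric sums are even -/
lemma aux_even (n : ℕ) (w : ℕ → ℤ) (hw : ∀ i < n, w (n - 1 - i) = w i)
    (hm : ∀ i < n, 2 * i + 1 = n → Even (w i)) : Even (∑ i ∈ range n, w i) := by
  rw [← ZMod.intCast_eq_zero_iff_even]
  push_cast
  refine Finset.sum_involution (fun i _ => n - 1 - i) ?_ ?_ ?_ ?_
  · intro i hi
    rw [hw i (by simpa using hi)]
    exact CharTwo.add_self_eq_zero _
  · intro i hi h0 h
    simp only [mem_range] at hi
    exact h0 ((ZMod.intCast_eq_zero_iff_even).2 (hm i hi (by omega)))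
  · intro i hi; simp only [mem_range] at *; omega
  · intro i hi; simp only [mem_range] at *; omega

/-- the terms divisible by `p` -/
lemma aux_div (M p t : ℕ) (hM : 0 < M) (hp : 0 < p) (hpt : IsCoprime (p : ℤ) t) (φ : ℤ → ℚ)
    (hφ : ∀ n, φ (n + t * (M * p)) = φ n) (k k' : ℤ) (hk : (t : ℤ) ∣ k - p * k') :
    ∑ i ∈ range (M * p), (if (p : ℤ) ∣ k + t * i then φ (k + t * i) else 0)
      = ∑ i ∈ range M, φ (p * (k' + t * i)) := by
  have : NeZero (M * p) := ⟨by positivity⟩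
  obtain ⟨j, hj⟩ := hk
  set P : ℤ → ℚ := fun i => if (p : ℤ) ∣ p * k' + t * i then φ (p * k' + t * i) else 0 with hP
  have h1 := aux_perm (M * p) P (by
    intro n
    simp only [hP]
    have e : (p : ℤ) * k' + t * (n + ((M * p : ℕ) : ℤ)) = (p * k' + t * n) + t * (M * p) := by
      push_cast; ring
    rw [e, hφ]
    have : (p : ℤ) ∣ p * k' + t * n + t * (M * p) ↔ (p : ℤ) ∣ p * k' + t * n :=
      dvd_add_left ⟨t * M, by ring⟩
    simp only [this]) 1 j isCoprime_one_left
  have h2 : ∀ i : ℕ, P (1 * (i : ℤ) + j) = if (p : ℤ) ∣ k + t * i then φ (k + t * i) else 0 := by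
    intro i
    have : (p : ℤ) * k' + t * (1 * i + j) = k + t * i := by linarith
    simp only [hP, this]
  simp only [h2] at h1
  rw [h1, aux_mul]
  apply Finset.sum_congr rfl
  intro i _
  rw [Finset.sum_eq_single 0]
  · simp only [hP]
    rw [if_pos]
    · congr 1; push_cast; ring
    · exact ⟨k' + t * i, by push_cast; ring⟩
  · intro b hb hb0
    simp only [mem_range] at hb
    simp only [hP]
    rw [if_neg]
    intro h
    have h3 : (p : ℤ) ∣ t * b := by
      have e : (t : ℤ) * b = (p * k' + t * (p * i + b)) - p * (k' + t * i) := by ring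
      rw [e]; exact dvd_sub h ⟨_, rfl⟩
    have h4 := hpt.dvd_of_dvd_mul_left h3
    have h5 : p ∣ b := by exact_mod_cast h4
    exact absurd (Nat.le_of_dvd (Nat.pos_of_ne_zero hb0) h5) (by omega)
  · intro h; simp at h; omega

structure SymDat (N : ℕ) (a : ℕ → ℤ) (S : ℚ → ℚ) : Prop where
  hN : Odd N
  hS0 : S 0 = 0
  hSneg : ∀ β : ℚ, S (-β) = S β
  hSper : ∀ β : ℚ, S (β + 1) = S β
  hHecke : ∀ ℓ : ℕ, ℓ.Prime → ¬(ℓ ∣ N) → ∀ β : ℚ, Nat.Coprime β.den N →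
      ∑ x ∈ Finset.range ℓ, S ((β + (x : ℚ)) / (ℓ : ℚ)) =
        (a ℓ : ℚ) * S β - S ((ℓ : ℚ) * β) + ∑ x ∈ Finset.range ℓ, S ((x : ℚ) / (ℓ : ℚ))
  ha2 : a 2 = 0
  hhalf : ∀ β : ℚ, ∃ c : ℤ, S β = (c : ℚ) / 2
  hv2 : S (1 / 2) = -1

/-- The Hecke constant. -/
def hC (S : ℚ → ℚ) (p : ℕ) : ℚ := ∑ x ∈ Finset.range p, S ((x : ℚ) / (p : ℚ))

namespace SymDat
variable {N : ℕ} {a : ℕ → ℤ} {S : ℚ → ℚ}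

lemma per_int (D : SymDat N a S) (β : ℚ) (n : ℤ) : S (β + n) = S β := by
  have h : Function.Periodic S (1 : ℚ) := D.hSper
  simpa using h.int_mul n β

lemma per_eq (D : SymDat N a S) (β γ : ℚ) (n : ℤ) (h : β = γ + n) : S β = S γ := by
  rw [h, D.per_int]

lemma den_cop (t : ℕ) (k : ℤ) (h : Nat.Coprime t N) : Nat.Coprime ((k : ℚ) / t).den N := by
  have h1 := Rat.den_dvd k t
  rw [← Rat.intCast_div_eq_divInt] at h1
  have h2 : ((k : ℚ) / t).den ∣ t := by exact_mod_cast h1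
  exact Nat.Coprime.coprime_dvd_left h2 h

lemma hB (D : SymDat N a S) (t p : ℕ) (ht : 0 < t) (hp : p.Prime) (hpN : ¬ p ∣ N)
    (htN : Nat.Coprime t N) (k : ℤ) :
    ∑ i ∈ range p, S (((k + t * i : ℤ) : ℚ) / (t * p)) =
      a p * S (k / t) - S ((p * k : ℤ) / t) + hC S p := by
  have h := D.hHecke p hp hpN (k / t) (den_cop t k htN)
  have hp0 : (p : ℚ) ≠ 0 := by exact_mod_cast hp.ne_zero
  have ht0 : (t : ℚ) ≠ 0 := by exact_mod_cast ht.ne'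
  have e : (p : ℚ) * (k / t) = ((p * k : ℤ) : ℚ) / t := by push_cast; ring
  rw [e] at h
  rw [hC, ← h]
  apply Finset.sum_congr rfl
  intro i _
  congr 1
  push_cast
  field_simp

lemma two (D : SymDat N a S) (t : ℕ) (ht : 0 < t) (htN : Nat.Coprime t N) (k : ℤ) :
    S (k / (2 * t)) + S (k / (2 * t) + 1 / 2) = - 1 - S ((2 * k : ℤ) / t) := by
  have h2 : ¬ 2 ∣ N := by have := D.hN; intro h; rw [← even_iff_two_dvd] at h; exact (Nat.not_even_iff_odd.2 this) h
  have h := D.hB t 2 ht Nat.prime_two h2 htN k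
  simp only [hC, Finset.sum_range_succ, Finset.sum_range_zero] at h
  have ht0 : (t : ℚ) ≠ 0 := by exact_mod_cast ht.ne'
  have e1 : ((k + t * ((0 : ℕ) : ℤ) : ℤ) : ℚ) / (t * ((2 : ℕ) : ℚ)) = k / (2 * t) := by push_cast; ring
  have e2 : ((k + t * ((1 : ℕ) : ℤ) : ℤ) : ℚ) / (t * ((2 : ℕ) : ℚ)) = k / (2 * t) + 1 / 2 := by
    push_cast; field_simp
  have e3 : (((1 : ℕ) : ℚ) / ((2 : ℕ) : ℚ)) = 1 / 2 := by norm_num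
  rw [e1, e2, e3, D.ha2, D.hv2] at h
  simp [D.hS0] at h
  push_cast
  linarith

lemma hC_int (D : SymDat N a S) (p : ℕ) (hp : Odd p) : ∃ c : ℤ, hC S p = c := by
  choose v hv using D.hhalf
  obtain ⟨r, hr⟩ := hp
  have hp0 : (p : ℚ) ≠ 0 := by rw [hr]; positivity
  have h1 : hC S p = ((∑ i ∈ range (p - 1), v (((i + 1 : ℕ) : ℚ) / p) : ℤ) : ℚ) / 2 := by
    have : p = (p - 1) + 1 := by omega
    rw [hC]
    conv_lhs => rw [show range p = range ((p - 1) + 1) by rw [← this]]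
    rw [Finset.sum_range_succ']
    simp only [Nat.cast_zero, zero_div, D.hS0, add_zero]
    push_cast
    rw [Finset.sum_div]
    apply Finset.sum_congr rfl
    intro i _
    rw [hv]
  have h2 := aux_even (p - 1) (fun i => v (((i + 1 : ℕ) : ℚ) / p)) (by
    intro i hi
    have e : S (((p - 1 - 1 - i + 1 : ℕ) : ℚ) / p) = S (((i + 1 : ℕ) : ℚ) / p) := by
      rw [← D.hSneg (((i + 1 : ℕ) : ℚ) / p)]
      apply D.per_eq _ _ 1
      have : ((p - 1 - 1 - i + 1 : ℕ) : ℚ) = p - (i + 1) := by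
        rw [eq_sub_iff_add_eq]; norm_cast; omega
      rw [this]; field_simp; push_cast; ring
    rw [hv, hv] at e
    have : (v (((p - 1 - 1 - i + 1 : ℕ) : ℚ) / p) : ℚ) = v (((i + 1 : ℕ) : ℚ) / p) := by linarith
    exact_mod_cast this) (by intro i hi h; omega)
  obtain ⟨c, hc⟩ := h2
  exact ⟨c, by rw [h1, hc]; push_cast; ring⟩

lemma S_odd_two (D : SymDat N a S) (k : ℤ) (hk : Odd k) : S ((k : ℚ) / (2 : ℕ)) = -1 := by
  obtain ⟨r, hr⟩ := hk
  rw [← D.hv2]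
  apply D.per_eq _ _ r
  rw [hr]; push_cast; ring

lemma hC_three (D : SymDat N a S) (p : ℕ) (hp : p.Prime) (hpo : Odd p) (hpN : ¬ p ∣ N) :
    3 * hC S p = a p - 1 - p := by
  have : NeZero p := ⟨hp.ne_zero⟩
  have hp0 : (p : ℚ) ≠ 0 := by exact_mod_cast hp.ne_zero
  have hpo' : Odd (p : ℤ) := by exact_mod_cast hpo
  have hpN' : Nat.Coprime p N := (Nat.Prime.coprime_iff_not_dvd hp).2 hpN
  have h2N : Nat.Coprime 2 N := (Nat.coprime_two_left).2 D.hN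
  have h1 := D.hB 2 p (by norm_num) hp hpN h2N 1
  rw [D.S_odd_two _ (by simp), D.S_odd_two _ (by simpa using hpo')] at h1
  have h2 : ∑ x ∈ range p, (S ((x : ℤ) / (2 * p)) + S ((x : ℤ) / (2 * p) + 1 / 2)) = - p - hC S p := by
    rw [Finset.sum_congr rfl (fun (x : ℕ) _ => D.two p hp.pos hpN' (x : ℤ))]
    rw [Finset.sum_sub_distrib]
    have := aux_perm p (fun n : ℤ => S ((n : ℚ) / p)) (by
      intro n; apply D.per_eq _ _ 1; push_cast; field_simp) 2 0 (by
        obtain ⟨r, hr⟩ := hpo'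
        exact ⟨-r, 1, by rw [hr]; ring⟩)
    simp only [add_zero] at this
    rw [this]
    simp [hC]
  have h3 : ∑ y ∈ range (2 * p), S (((y : ℤ) : ℚ) / (2 * p)) =
      ∑ x ∈ range p, (S ((x : ℤ) / (2 * p)) + S ((x : ℤ) / (2 * p) + 1 / 2)) := by
    rw [aux_mul' 2 p (fun n : ℤ => S ((n : ℚ) / (2 * p)))]
    apply Finset.sum_congr rfl
    intro j _
    rw [Finset.sum_range_succ, Finset.sum_range_one]
    congr 2
    · push_cast; ring
    · push_cast; field_simp; ring
  have h4 : ∑ y ∈ range (2 * p), S (((y : ℤ) : ℚ) / (2 * p)) =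
      hC S p + ∑ i ∈ range p, S (((1 + (2 : ℕ) * i : ℤ) : ℚ) / ((2 : ℕ) * p)) := by
    rw [mul_comm 2 p, aux_mul' p 2 (fun n : ℤ => S ((n : ℚ) / (2 * p)))]
    rw [Finset.sum_range_succ, Finset.sum_range_one, hC]
    congr 1
    · apply Finset.sum_congr rfl; intro i _; congr 1; push_cast; field_simp; ring
    · apply Finset.sum_congr rfl; intro i _; congr 1; push_cast; ring
  rw [h1] at h4
  rw [h4, h2] at h3
  linarith

lemma hC_odd (D : SymDat N a S) (p : ℕ) (hp : p.Prime) (hpo : Odd p) (hpN : ¬ p ∣ N)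
    (hap : Odd (a p)) : ∃ c : ℤ, Odd c ∧ hC S p = c := by
  obtain ⟨c, hc⟩ := D.hC_int p hpo
  refine ⟨c, ?_, hc⟩
  have h := D.hC_three p hp hpo hpN
  rw [hc] at h
  have h' : 3 * c = a p - 1 - p := by exact_mod_cast h
  obtain ⟨r, hr⟩ := hpo
  obtain ⟨s, hs⟩ := hap
  rw [Int.odd_iff]; subst hr; push_cast at h'; omega

end SymDat

/-- signed sum -/
def fS (S : ℚ → ℚ) (m t : ℕ) (k : ℤ) : ℚ :=
  ∑ i ∈ range m, (jacobiSym (k + t * i) m : ℚ) * S (((k + t * i : ℤ) : ℚ) / (t * m))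

/-- unsigned sum -/
def uS (S : ℚ → ℚ) (m t : ℕ) (k : ℤ) : ℚ :=
  ∑ i ∈ range m, ((jacobiSym (k + t * i) m) ^ 2 : ℚ) * S (((k + t * i : ℤ) : ℚ) / (t * m))

lemma jac_sq (p q : ℕ) (hp : p.Prime) (hq : q.Prime) (hpq : p ≠ q) (n : ℤ) :
    ((jacobiSym n (p * q)) ^ 2 : ℚ) = 1 - (if (p : ℤ) ∣ n then 1 else 0) -
      (if (q : ℤ) ∣ n then 1 else 0) + (if ((p * q : ℕ) : ℤ) ∣ n then 1 else 0) := by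
  have hc : Nat.Coprime p q := (Nat.coprime_primes hp hq).2 hpq
  have key : ∀ r : ℕ, r.Prime → ((jacobiSym n r) ^ 2 : ℚ) = 1 - (if (r : ℤ) ∣ n then 1 else 0) := by
    intro r hr
    have : NeZero r := ⟨hr.ne_zero⟩
    split_ifs with h
    · have : jacobiSym n r = 0 := by
        rw [jacobiSym.eq_zero_iff_not_coprime]
        intro h1
        have h2 : (r : ℤ) ∣ ((Int.gcd n r : ℕ) : ℤ) := Int.dvd_coe_gcd h (dvd_refl _)
        rw [h1] at h2
        exact hr.one_lt.ne' (Nat.dvd_one.1 (by exact_mod_cast h2))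
      simp [this]
    · have : Int.gcd n r = 1 := by
        rw [Int.gcd_comm]
        exact Int.isCoprime_iff_gcd_eq_one.1 ((Nat.prime_iff_prime_int.1 hr).coprime_iff_not_dvd.2 h)
      have := jacobiSym.sq_one this
      have h2 : ((jacobiSym n r) ^ 2 : ℚ) = 1 := by exact_mod_cast this
      rw [h2]; ring
  have : NeZero p := ⟨hp.ne_zero⟩
  have : NeZero q := ⟨hq.ne_zero⟩
  rw [jacobiSym.mul_right]
  push_cast
  rw [mul_pow, key p hp, key q hq]
  have h : ((p : ℤ) * q) ∣ n ↔ (p : ℤ) ∣ n ∧ (q : ℤ) ∣ n := by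
    constructor
    · intro h; exact ⟨dvd_of_mul_right_dvd h, dvd_of_mul_left_dvd h⟩
    · rintro ⟨h1, h2⟩; exact (Nat.isCoprime_iff_coprime.2 hc).mul_dvd h1 h2
  by_cases h1 : (p : ℤ) ∣ n <;> by_cases h2 : (q : ℤ) ∣ n <;> simp [h, h1, h2]

namespace SymDat
variable {N : ℕ} {a : ℕ → ℤ} {S : ℚ → ℚ}

lemma uS_formula (D : SymDat N a S) (t p q : ℕ) (ht : 0 < t) (hp : p.Prime) (hpN : ¬ p ∣ N)
    (hq : q.Prime) (hqN : ¬ q ∣ N) (hpq : p ≠ q)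
    (htN : Nat.Coprime t N) (htp : Nat.Coprime p t) (htq : Nat.Coprime q t) (p' q' : ℤ)
    (hp' : (t : ℤ) ∣ 1 - p * p') (hq' : (t : ℤ) ∣ 1 - q * q') (k : ℤ) :
    uS S (p * q) t k = a q * (a p * S (k / t) - S ((p * k : ℤ) / t) + hC S p)
      - (a p * S ((q * k : ℤ) / t) - S ((p * (q * k) : ℤ) / t) + hC S p) + p * hC S q
      - (a q * S ((p' * k : ℤ) / t) - S ((q * (p' * k) : ℤ) / t) + hC S q)
      - (a p * S ((q' * k : ℤ) / t) - S ((p * (q' * k) : ℤ) / t) + hC S p)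
      + S ((p' * (q' * k) : ℤ) / t) := by
  have : NeZero p := ⟨hp.ne_zero⟩
  have hp0 : (p : ℚ) ≠ 0 := by exact_mod_cast hp.ne_zero
  have hq0 : (q : ℚ) ≠ 0 := by exact_mod_cast hq.ne_zero
  have ht0 : (t : ℚ) ≠ 0 := by exact_mod_cast ht.ne'
  have hcpq : Nat.Coprime p q := (Nat.coprime_primes hp hq).2 hpq
  set φ : ℤ → ℚ := fun n => S ((n : ℚ) / (t * (p * q))) with hφ
  have hφper : ∀ n : ℤ, φ (n + t * (p * q)) = φ n := by
    intro n; apply D.per_eq _ _ 1; push_cast; field_simp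
  -- the full sum
  have hA : ∑ i ∈ range (p * q), φ (k + t * i) =
      a q * (a p * S (k / t) - S ((p * k : ℤ) / t) + hC S p)
      - (a p * S ((q * k : ℤ) / t) - S ((p * (q * k) : ℤ) / t) + hC S p) + p * hC S q := by
    rw [mul_comm p q, aux_mul' q p (fun i : ℤ => φ (k + t * i))]
    have h1 : ∀ j : ℕ, ∑ i ∈ range q, φ (k + t * (p * i + j)) =
        a q * S (((k + t * j : ℤ) : ℚ) / (t * p)) - S (((q * k + t * (q * j) : ℤ) : ℚ) / (t * p)) + hC S q := by
      intro j
      have := D.hB (t * p) q (by have := hp.pos; positivity) hq hqN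
        (Nat.Coprime.mul_left htN ((Nat.Prime.coprime_iff_not_dvd hp).2 hpN)) (k + t * j)
      have e : (q : ℤ) * (k + t * j) = q * k + t * (q * j) := by ring
      rw [e] at this
      push_cast at this ⊢
      rw [← this]
      apply Finset.sum_congr rfl
      intro i _
      simp only [hφ]
      congr 1; push_cast; ring
    simp only [h1]
    rw [Finset.sum_add_distrib, Finset.sum_sub_distrib, ← Finset.mul_sum, D.hB t p ht hp hpN htN]
    have h2 := aux_perm p (fun n : ℤ => S (((q * k + t * n : ℤ) : ℚ) / (t * p))) (by
      intro n; apply D.per_eq _ _ 1; push_cast; field_simp; try ring) q 0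
        (Nat.isCoprime_iff_coprime.2 hcpq.symm)
    simp only [add_zero] at h2
    rw [h2, D.hB t p ht hp hpN htN]
    simp
  have hP : ∑ i ∈ range (p * q), (if (p : ℤ) ∣ k + t * i then φ (k + t * i) else 0) =
      (a q * S ((p' * k : ℤ) / t) - S ((q * (p' * k) : ℤ) / t) + hC S q) := by
    rw [mul_comm p q, aux_div q p t hq.pos hp.pos (Nat.isCoprime_iff_coprime.2 htp) φ
      (by intro n; rw [← hφper n]; congr 1; ring) k (p' * k) (by
        obtain ⟨c, hc⟩ := hp'; exact ⟨c * k, by linear_combination k * hc⟩)]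
    rw [← D.hB t q ht hq hqN htN]
    apply Finset.sum_congr rfl
    intro i _
    simp only [hφ]; congr 1; push_cast; field_simp
  have hQ : ∑ i ∈ range (p * q), (if (q : ℤ) ∣ k + t * i then φ (k + t * i) else 0) =
      (a p * S ((q' * k : ℤ) / t) - S ((p * (q' * k) : ℤ) / t) + hC S p) := by
    rw [aux_div p q t hp.pos hq.pos (Nat.isCoprime_iff_coprime.2 htq) φ
      hφper k (q' * k) (by
        obtain ⟨c, hc⟩ := hq'; exact ⟨c * k, by linear_combination k * hc⟩)]
    rw [← D.hB t p ht hp hpN htN]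
    apply Finset.sum_congr rfl
    intro i _
    simp only [hφ]; congr 1; push_cast; field_simp
  have hPQ : ∑ i ∈ range (p * q), (if ((p * q : ℕ) : ℤ) ∣ k + t * i then φ (k + t * i) else 0) =
      S ((p' * (q' * k) : ℤ) / t) := by
    have := aux_div 1 (p * q) t one_pos (Nat.mul_pos hp.pos hq.pos)
      (Nat.isCoprime_iff_coprime.2 (Nat.Coprime.mul_left htp htq)) φ
      (by intro n; rw [← hφper n]; congr 1; push_cast; ring) k (p' * (q' * k)) (by
        obtain ⟨c, hc⟩ := hq'; obtain ⟨d, hd⟩ := hp'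
        exact ⟨c * k + q * q' * k * d, by push_cast; linear_combination k * hc + q * q' * k * hd⟩)
    rw [one_mul] at this
    rw [this]
    simp only [Finset.sum_range_one, hφ]; congr 1; push_cast; field_simp; ring
  rw [← hPQ, ← hP, ← hQ, ← hA, ← Finset.sum_sub_distrib, ← Finset.sum_sub_distrib, ← Finset.sum_add_distrib, uS]
  apply Finset.sum_congr rfl
  intro i _
  rw [jac_sq p q hp hq hpq]
  have e : S (((k + t * i : ℤ) : ℚ) / (t * ((p * q : ℕ) : ℚ))) = φ (k + t * i) := by
    simp only [hφ]; push_cast; rfl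
  rw [e]
  split_ifs <;> ring

end SymDat

lemma jac_per (m : ℕ) (n l : ℤ) : jacobiSym (n + m * l) m = jacobiSym n m := by
  rw [jacobiSym.mod_left, Int.add_mul_emod_self_left, ← jacobiSym.mod_left]

lemma jac_neg (m : ℕ) (hm : m % 4 = 1) (n : ℤ) : jacobiSym (-n) m = jacobiSym n m := by
  rw [jacobiSym.neg _ (Nat.odd_iff.2 (by omega)), ZMod.χ₄_nat_one_mod_four hm, one_mul]

namespace SymDat
variable {N : ℕ} {a : ℕ → ℤ} {S : ℚ → ℚ}

lemma P_per (D : SymDat N a S) (m t : ℕ) (hm : 0 < m) (ht : 0 < t) (k n : ℤ) :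
    (jacobiSym (k + t * (n + m)) m : ℚ) * S (((k + t * (n + m) : ℤ) : ℚ) / (t * m)) =
    (jacobiSym (k + t * n) m : ℚ) * S (((k + t * n : ℤ) : ℚ) / (t * m)) := by
  have hm0 : (m : ℚ) ≠ 0 := by exact_mod_cast hm.ne'
  have ht0 : (t : ℚ) ≠ 0 := by exact_mod_cast ht.ne'
  congr 1
  · rw [← jac_per m (k + t * n) t]; congr 2; ring
  · apply D.per_eq _ _ 1; push_cast; field_simp; ring

lemma f_per (D : SymDat N a S) (m t : ℕ) (hm : 0 < m) (ht : 0 < t) (k n : ℤ) :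
    fS S m t (k + t * n) = fS S m t k := by
  have : NeZero m := ⟨hm.ne'⟩
  rw [fS, fS, ← aux_perm m (fun i : ℤ => (jacobiSym (k + t * i) m : ℚ) * S (((k + t * i : ℤ) : ℚ) / (t * m)))
    (fun n => D.P_per m t hm ht k n) 1 n isCoprime_one_left]
  apply Finset.sum_congr rfl
  intro i _
  have : k + t * n + t * i = k + t * (1 * i + n) := by ring
  rw [this]

lemma f_neg (D : SymDat N a S) (m t : ℕ) (hm : m % 4 = 1) (ht : 0 < t) (k : ℤ) :
    fS S m t (-k) = fS S m t k := by
  have hm0 : 0 < m := by omega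
  have : NeZero m := ⟨hm0.ne'⟩
  rw [fS, fS, ← aux_perm m (fun i : ℤ => (jacobiSym (k + t * i) m : ℚ) * S (((k + t * i : ℤ) : ℚ) / (t * m)))
    (fun n => D.P_per m t hm0 ht k n) (-1) 0 (isCoprime_one_left.neg_left)]
  apply Finset.sum_congr rfl
  intro i _
  have : k + t * (-1 * i + 0) = -(-k + t * i) := by ring
  rw [this, jac_neg m hm, ← D.hSneg]
  congr 2
  push_cast; ring

/-- the Hecke relation at two for the twisted sums -/
lemma f_two (D : SymDat N a S) (m s : ℕ) (hm : Odd m) (hs : 0 < s) (hsN : Nat.Coprime s N)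
    (hmN : Nat.Coprime m N) (hms : Nat.Coprime s m) (k : ℤ) :
    fS S m (4 * s) k + fS S m (4 * s) (k + 2 * s) =
      - ((∑ i ∈ range m, jacobiSym i m : ℤ) : ℚ) - fS S m s k := by
  have hm0 : 0 < m := hm.pos
  have : NeZero m := ⟨hm0.ne'⟩
  have hmq : (m : ℚ) ≠ 0 := by exact_mod_cast hm0.ne'
  have hsq : (s : ℚ) ≠ 0 := by exact_mod_cast hs.ne'
  have h2N : Nat.Coprime 2 N := (Nat.coprime_two_left).2 D.hN
  have h4m : Nat.Coprime 4 m := by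
    have : Nat.Coprime 2 m := (Nat.coprime_two_left).2 hm
    exact Nat.Coprime.mul_left this this
  obtain ⟨r, hr⟩ := hm
  have e1 : fS S m (4 * s) (k + 2 * s) = fS S m (4 * s) (k + 2 * s * m) := by
    rw [← D.f_per m (4 * s) hm0 (by positivity) (k + 2 * s) r, hr]
    congr 1; push_cast; ring
  have e2 : fS S m s k = ∑ i ∈ range m, (jacobiSym (k + (4 * s : ℕ) * i) m : ℚ) *
      S (((k + (4 * s : ℕ) * i : ℤ) : ℚ) / (s * m)) := by
    rw [fS, ← aux_perm m (fun i : ℤ => (jacobiSym (k + s * i) m : ℚ) * S (((k + s * i : ℤ) : ℚ) / (s * m)))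
      (fun n => D.P_per m s hm0 hs k n) 4 0 (by exact_mod_cast Nat.isCoprime_iff_coprime.2 h4m)]
    apply Finset.sum_congr rfl
    intro i _
    have : k + (s : ℤ) * (4 * i + 0) = k + (4 * s : ℕ) * i := by push_cast; ring
    rw [this]
  have e3 : ∑ i ∈ range m, jacobiSym i m = ∑ i ∈ range m, jacobiSym (k + (4 * s : ℕ) * i) m := by
    rw [← aux_perm m (fun i : ℤ => jacobiSym i m)
      (fun n => by simpa using jac_per m n 1) (4 * s : ℕ) k
        (Nat.isCoprime_iff_coprime.2 (Nat.Coprime.mul_left h4m hms))]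
    apply Finset.sum_congr rfl
    intro i _
    rw [add_comm]
  rw [e1, e2, e3, fS, fS]
  push_cast
  rw [← Finset.sum_add_distrib, ← Finset.sum_neg_distrib, ← Finset.sum_sub_distrib]
  apply Finset.sum_congr rfl
  intro i _
  have e4 : jacobiSym (k + 2 * s * m + 4 * s * i) m = jacobiSym (k + 4 * s * i) m := by
    rw [← jac_per m (k + 4 * s * i) (2 * s)]; congr 1; ring
  have h := D.two (2 * s * m) (by positivity) (Nat.Coprime.mul_left (Nat.Coprime.mul_left h2N hsN) hmN)
    (k + 4 * s * i)
  have e5 : ((k + 4 * s * i : ℤ) : ℚ) / (2 * ((2 * s * m : ℕ) : ℚ)) = (k + 4 * s * i) / (4 * s * m) := by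
    push_cast; ring
  have e6 : ((k : ℚ) + 4 * s * i) / (4 * s * m) + 1 / 2 = (k + 2 * s * m + 4 * s * i) / (4 * s * m) := by
    field_simp; ring
  have e7 : ((2 * (k + 4 * s * i) : ℤ) : ℚ) / ((2 * s * m : ℕ) : ℚ) = (k + 4 * s * i) / (s * m) := by
    push_cast; field_simp
  rw [e5, e6, e7] at h
  rw [e4]
  linear_combination (jacobiSym (k + 4 * s * i) m : ℚ) * h

lemma J_div (m : ℕ) (n : ℤ) (v : ℤ) : ((jacobiSym n m : ℤ) : ℚ) * ((v : ℚ) / 2) =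
    ((jacobiSym n m) ^ 2 : ℚ) * ((v : ℚ) / 2) + (((jacobiSym n m - jacobiSym n m ^ 2) / 2 * v : ℤ) : ℚ) := by
  rcases jacobiSym.trichotomy n m with h | h | h <;> rw [h] <;> norm_num <;> ring

lemma f_u (D : SymDat N a S) (m t : ℕ) (k : ℤ) : ∃ z : ℤ, fS S m t k = uS S m t k + z := by
  choose v hv using D.hhalf
  refine ⟨∑ i ∈ range m, (jacobiSym (k + t * i) m - jacobiSym (k + t * i) m ^ 2) / 2 *
    v (((k + t * i : ℤ) : ℚ) / (t * m)), ?_⟩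
  rw [fS, uS, Int.cast_sum, ← Finset.sum_add_distrib]
  apply Finset.sum_congr rfl
  intro i _
  rw [hv, J_div]

lemma sym_aux (m i : ℕ) (hi : i < m) : ((1 + (2 : ℕ) * (m - 1 - i : ℕ) : ℤ)) = -(1 + (2 : ℕ) * i) + m * 2 := by
  have : m - 1 - i = ((m : ℤ) - 1 - i) := by ring
  have h : ((m - 1 - i : ℕ) : ℤ) = (m : ℤ) - 1 - i := by omega
  rw [h]; push_cast; ring

lemma J_mid (m i : ℕ) (hm : 1 < m) (h : 2 * i + 1 = m) : jacobiSym (1 + (2 : ℕ) * i) m = 0 := by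
  have e : (1 + (2 : ℕ) * i : ℤ) = 0 + m * 1 := by rw [← h]; push_cast; ring
  rw [e, jac_per, jacobiSym.zero_left hm]

lemma f_u_two (D : SymDat N a S) (m : ℕ) (hm : m % 4 = 1) (hm1 : 1 < m) :
    ∃ z : ℤ, Even z ∧ fS S m 2 1 = uS S m 2 1 + z := by
  choose v hv using D.hhalf
  have hmq : (m : ℚ) ≠ 0 := by have : m ≠ 0 := by omega
                               exact_mod_cast this
  refine ⟨∑ i ∈ range m, (jacobiSym (1 + (2 : ℕ) * i) m - jacobiSym (1 + (2 : ℕ) * i) m ^ 2) / 2 *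
    v (((1 + (2 : ℕ) * i : ℤ) : ℚ) / ((2 : ℕ) * m)), ?_, ?_⟩
  · apply aux_even m
    · intro i hi
      rw [sym_aux m i hi, jac_per, jac_neg m hm]
      congr 1
      have e : S (((-(1 + (2 : ℕ) * i) + m * 2 : ℤ) : ℚ) / ((2 : ℕ) * m)) =
          S (((1 + (2 : ℕ) * i : ℤ) : ℚ) / ((2 : ℕ) * m)) := by
        rw [← D.hSneg (((1 + (2 : ℕ) * i : ℤ) : ℚ) / ((2 : ℕ) * m))]
        apply D.per_eq _ _ 1
        push_cast; field_simp
      rw [hv, hv] at e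
      have e' := mul_right_cancel₀ (b := (2 : ℚ)⁻¹) (by norm_num) e
      exact_mod_cast e'
    · intro i hi h
      rw [J_mid m i hm1 h]; simp
  · rw [fS, uS, Int.cast_sum, ← Finset.sum_add_distrib]
    apply Finset.sum_congr rfl
    intro i _
    rw [hv, J_div]

lemma J_sum_even (m : ℕ) (hm : m % 4 = 1) (hm1 : 1 < m) : Even (∑ i ∈ range m, jacobiSym i m) := by
  have : NeZero m := ⟨by omega⟩
  rw [← aux_perm m (fun i : ℤ => jacobiSym i m)
      (fun n => by simpa using jac_per m n 1) (2 : ℕ) 1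
        (Nat.isCoprime_iff_coprime.2 ((Nat.coprime_two_left).2 (Nat.odd_iff.2 (by omega))))]
  apply aux_even m
  · intro i hi
    have := sym_aux m i hi
    rw [add_comm] at this
    rw [this, jac_per, jac_neg m hm, add_comm]
  · intro i hi h
    rw [add_comm, J_mid m i hm1 h]; simp

lemma h_even (D : SymDat N a S) (p q : ℕ) (hp : p.Prime) (hpN : ¬ p ∣ N)
    (hq : q.Prime) (hqN : ¬ q ∣ N) (hpq : p ≠ q) (hp4 : p % 4 = 3) (hq4 : q % 4 = 3)
    (hap : Odd (a p)) (haq : Odd (a q)) : ∃ z : ℤ, Even z ∧ fS S (p * q) 2 1 = z := by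
  have hpo : Odd p := Nat.odd_iff.2 (by omega)
  have hqo : Odd q := Nat.odd_iff.2 (by omega)
  have hpo' : Odd (p : ℤ) := by exact_mod_cast hpo
  have hqo' : Odd (q : ℤ) := by exact_mod_cast hqo
  obtain ⟨z, hz, h⟩ := D.f_u_two (p * q) (by rw [Nat.mul_mod, hp4, hq4])
    (by nlinarith [hp.two_le, hq.two_le])
  have h2N : Nat.Coprime 2 N := (Nat.coprime_two_left).2 D.hN
  have hu := D.uS_formula 2 p q two_pos hp hpN hq hqN hpq h2N (Nat.coprime_two_right.2 hpo)
    (Nat.coprime_two_right.2 hqo) 1 1 (by push_cast; omega) (by push_cast; omega) 1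
  obtain ⟨x, hx, hx'⟩ := D.hC_odd p hp hpo hpN hap
  obtain ⟨y, hy, hy'⟩ := D.hC_odd q hq hqo hqN haq
  rw [D.S_odd_two _ (by simp), D.S_odd_two _ (by simpa using hpo'), D.S_odd_two _ (by simpa using hqo'),
    D.S_odd_two _ (by simpa using hpo'.mul hqo'), D.S_odd_two _ (by simp), D.S_odd_two _ (by simpa using hqo'),
    D.S_odd_two _ (by simpa using hpo'), D.S_odd_two _ (by simp), hx', hy'] at hu
  refine ⟨-(a q - 2) * (a p - 2) + (a q - 2) * x + (p - 1) * y + z, ?_, ?_⟩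
  · have h1 : Odd (a q - 2) := haq.sub_even even_two
    have h2 : Odd (a p - 2) := hap.sub_even even_two
    have h3 : Even ((p : ℤ) - 1) := hpo'.sub_odd odd_one
    exact (((h1.neg.mul h2).add_odd (h1.mul hx)).add (h3.mul_right y)).add hz
  · rw [h, hu]; push_cast; ring

end SymDat

/-- parity of twice the symbol at level 32 -/
def ind32 (k : ZMod 32) : ZMod 2 :=
  if k = 3 ∨ k = 29 ∨ k = 7 ∨ k = 25 ∨ k = 9 ∨ k = 23 ∨ k = 13 ∨ k = 19 then 1 else 0

/-- the nine-term sum -/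
def nine (P Q k : ZMod 32) : ZMod 2 :=
  ind32 k + ind32 (P * k) + ind32 (Q * k) + ind32 (P * (Q * k)) + ind32 (P ^ 7 * k)
    + ind32 (Q * (P ^ 7 * k)) + ind32 (Q ^ 7 * k) + ind32 (P * (Q ^ 7 * k)) + ind32 (P ^ 7 * (Q ^ 7 * k))

set_option maxRecDepth 100000 in
lemma nine_rel : ∀ i j : Fin 16, 
    let P : ZMod 32 := 2 * (i.val : ZMod 32) + 1
    let Q : ZMod 32 := 2 * (j.val : ZMod 32) + 1
    nine P Q 1 = nine P Q 5 ∧ nine P Q 7 = nine P Q 3 ∧ nine P Q 1 = nine P Q 7 + 1 := by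
  decide +kernel

lemma nine_rel' (p q : ℕ) (hp : Odd p) (hq : Odd q) :
    nine p q 1 = nine p q 5 ∧ nine p q 7 = nine p q 3 ∧ nine p q 1 = nine p q 7 + 1 := by
  have key : ∀ p : ℕ, Odd p → ∃ i : Fin 16, (p : ZMod 32) = 2 * (i.val : ZMod 32) + 1 := by
    intro p hp
    obtain ⟨r, hr⟩ := hp
    refine ⟨⟨r % 16, Nat.mod_lt _ (by norm_num)⟩, ?_⟩
    have : ((2 * (r % 16) + 1 : ℕ) : ZMod 32) = 2 * ((r % 16 : ℕ) : ZMod 32) + 1 := by push_cast; rfl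
    rw [← this, ZMod.natCast_eq_natCast_iff]
    unfold Nat.ModEq; omega
  obtain ⟨i, hi⟩ := key p hp
  obtain ⟨j, hj⟩ := key q hq
  rw [hi, hj]
  exact nine_rel i j

lemma pow8 (p : ℕ) (hp : Odd p) : ((32 : ℕ) : ℤ) ∣ 1 - p * (p : ℤ) ^ 7 := by
  have h : ∀ i : Fin 32, i.val % 2 = 1 → (i.val : ZMod 32) ^ 8 = 1 := by decide
  have h1 := h ⟨p % 32, Nat.mod_lt _ (by norm_num)⟩ (by have := Nat.odd_iff.1 hp; simp only; omega)
  simp only [ZMod.natCast_mod] at h1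
  have h2 : (p : ZMod 32) ^ 8 = 1 := by
    rw [← h1]
  rw [← ZMod.intCast_eq_intCast_iff_dvd_sub]
  push_cast
  rw [← h2]; ring

lemma sq8 (p : ℕ) (hp : Odd p) : ((8 : ℕ) : ℤ) ∣ 1 - p * (p : ℤ) := by
  have h := Int.sq_mod_four_eq_one_of_odd (x := p) (by exact_mod_cast hp)
  have h1 := Int.eight_dvd_sq_sub_one_of_odd (k := (p : ℤ)) (by exact_mod_cast hp)
  have : 1 - (p : ℤ) * p = -((p : ℤ) ^ 2 - 1) := by ring
  rw [this]; exact (dvd_neg).2 h1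

structure SymDat32 (N : ℕ) (a : ℕ → ℤ) (S : ℚ → ℚ) : Prop extends SymDat N a S where
  hv8 : ∀ x : ℤ, Odd x → S ((x : ℚ) / 8) = 0
  hv32a : S (3 / 32) = -(1 / 2)
  hv32b : S (7 / 32) = -(1 / 2)
  hv32c : S (9 / 32) = -(1 / 2)
  hv32d : S (13 / 32) = -(1 / 2)
  hv32e : S (11 / 32) = -1
  hv32f : S (15 / 32) = -1
  hv32g : S (1 / 32) = 0
  hv32h : S (5 / 32) = 0

namespace SymDat32
variable {N : ℕ} {a : ℕ → ℤ} {S : ℚ → ℚ}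

lemma v32 (D : SymDat32 N a S) (k : ℤ) (hk : Odd k) :
    ∃ v : ℤ, S ((k : ℚ) / (32 : ℕ)) = v / 2 ∧ (v : ZMod 2) = ind32 (k : ZMod 32) := by
  have hr : k % 32 < 32 := Int.emod_lt_of_pos _ (by norm_num)
  have hr0 : 0 ≤ k % 32 := Int.emod_nonneg _ (by norm_num)
  have ho : (k % 32) % 2 = 1 := by have := Int.odd_iff.1 hk; omega
  have e1 : S ((k : ℚ) / (32 : ℕ)) = S (((k % 32 : ℤ) : ℚ) / 32) := by
    apply D.per_eq _ _ (k / 32)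
    have := Int.emod_add_mul_ediv k 32
    have h' : (k : ℚ) = ((k % 32 : ℤ) : ℚ) + 32 * ((k / 32 : ℤ) : ℚ) := by exact_mod_cast this.symm
    rw [h']; push_cast; field_simp
  have e2 : (k : ZMod 32) = ((k % 32 : ℤ) : ZMod 32) := by
    rw [ZMod.intCast_eq_intCast_iff]; exact (Int.mod_modEq k 32).symm
  have e3 : S ((k : ℚ) / (32 : ℕ)) = S (((32 - k % 32 : ℤ) : ℚ) / 32) := by
    rw [e1, ← D.hSneg]
    symm
    apply D.per_eq _ _ 1
    push_cast; ring
  rw [e2]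
  have a1 := D.hv32a
  have a2 := D.hv32b
  have a3 := D.hv32c
  have a4 := D.hv32d
  have a5 := D.hv32e
  have a6 := D.hv32f
  have a7 := D.hv32g
  have a8 := D.hv32h
  generalize k % 32 = r at *
  generalize S ((k : ℚ) / (32 : ℕ)) = X at *
  interval_cases r <;> first
    | (exfalso; revert ho; norm_num; done)
    | (refine ⟨0, ?_, by decide⟩; first | (rw [e1]; norm_num; assumption) | (rw [e3]; norm_num; assumption))
    | (refine ⟨-1, ?_, by decide⟩
       first
        | (rw [e1]; norm_num at *; linarith)
        | (rw [e3]; norm_num at *; linarith))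
    | (refine ⟨-2, ?_, by decide⟩
       first
        | (rw [e1]; norm_num at *; linarith)
        | (rw [e3]; norm_num at *; linarith))

lemma w32 (D : SymDat32 N a S) (p q : ℕ) (hp : p.Prime) (hpN : ¬ p ∣ N)
    (hq : q.Prime) (hqN : ¬ q ∣ N) (hpq : p ≠ q) (hpo : Odd p) (hqo : Odd q)
    (hap : Odd (a p)) (haq : Odd (a q)) (k : ℤ) (hk : Odd k) :
    ∃ w : ℤ, fS S (p * q) 32 k = w / 2 ∧ (w : ZMod 2) = nine p q k := by
  have hpo' : Odd (p : ℤ) := by exact_mod_cast hpo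
  have hqo' : Odd (q : ℤ) := by exact_mod_cast hqo
  obtain ⟨z, h⟩ := D.f_u (p * q) 32 k
  have h2 : ∀ n, Odd n → Nat.Coprime n 32 := fun n hn =>
    Nat.Coprime.pow_right 5 (Nat.coprime_two_right.2 hn)
  have hu := D.uS_formula 32 p q (by norm_num) hp hpN hq hqN hpq (h2 _ D.hN).symm (h2 _ hpo)
    (h2 _ hqo) (p ^ 7) (q ^ 7) (pow8 p hpo) (pow8 q hqo) k
  obtain ⟨x, hx'⟩ := D.hC_int p hpo
  obtain ⟨y, hy'⟩ := D.hC_int q hqo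
  obtain ⟨v1, h1, g1⟩ := D.v32 k hk
  obtain ⟨v2, h2, g2⟩ := D.v32 (p * k) (hpo'.mul hk)
  obtain ⟨v3, h3, g3⟩ := D.v32 (q * k) (hqo'.mul hk)
  obtain ⟨v4, h4, g4⟩ := D.v32 (p * (q * k)) (hpo'.mul (hqo'.mul hk))
  obtain ⟨v5, h5, g5⟩ := D.v32 (p ^ 7 * k) (hpo'.pow.mul hk)
  obtain ⟨v6, h6, g6⟩ := D.v32 (q * (p ^ 7 * k)) (hqo'.mul (hpo'.pow.mul hk))
  obtain ⟨v7, h7, g7⟩ := D.v32 (q ^ 7 * k) (hqo'.pow.mul hk)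
  obtain ⟨v8, h8, g8⟩ := D.v32 (p * (q ^ 7 * k)) (hpo'.mul (hqo'.pow.mul hk))
  obtain ⟨v9, h9, g9⟩ := D.v32 (p ^ 7 * (q ^ 7 * k)) (hpo'.pow.mul (hqo'.pow.mul hk))
  rw [h1, h2, h3, h4, h5, h6, h7, h8, h9, hx', hy'] at hu
  refine ⟨a q * (a p * v1 - v2 + 2 * x) - (a p * v3 - v4 + 2 * x) + p * (2 * y) - (a q * v5 - v6 + 2 * y)
    - (a p * v7 - v8 + 2 * x) + v9 + 2 * z, ?_, ?_⟩
  · rw [h, hu]; push_cast; ring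
  · have t2 : (2 : ZMod 2) = 0 := by decide
    have m1 : ∀ x : ZMod 2, -x = x := by decide
    have o1 : (a p : ZMod 2) = 1 := ZMod.intCast_eq_one_iff_odd.2 hap
    have o2 : (a q : ZMod 2) = 1 := ZMod.intCast_eq_one_iff_odd.2 haq
    push_cast
    rw [g1, g2, g3, g4, g5, g6, g7, g8, g9, o1, o2, t2]
    simp only [sub_eq_add_neg, m1, neg_add]
    unfold nine
    push_cast
    ring

lemma g8 (D : SymDat32 N a S) (p q : ℕ) (hp : p.Prime) (hpN : ¬ p ∣ N)
    (hq : q.Prime) (hqN : ¬ q ∣ N) (hpq : p ≠ q) (hpo : Odd p) (hqo : Odd q)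
    (k : ℤ) (hk : Odd k) :
    ∃ w : ℤ, fS S (p * q) 8 k = w := by
  have hpo' : Odd (p : ℤ) := by exact_mod_cast hpo
  have hqo' : Odd (q : ℤ) := by exact_mod_cast hqo
  obtain ⟨z, h⟩ := D.f_u (p * q) 8 k
  have h2 : ∀ n, Odd n → Nat.Coprime n 8 := fun n hn =>
    Nat.Coprime.pow_right 3 (Nat.coprime_two_right.2 hn)
  have hu := D.uS_formula 8 p q (by norm_num) hp hpN hq hqN hpq (h2 _ D.hN).symm (h2 _ hpo)
    (h2 _ hqo) p q (sq8 p hpo) (sq8 q hqo) k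
  obtain ⟨x, hx'⟩ := D.hC_int p hpo
  obtain ⟨y, hy'⟩ := D.hC_int q hqo
  have hv : ∀ k : ℤ, Odd k → S ((k : ℚ) / (8 : ℕ)) = 0 := fun k hk => by exact_mod_cast D.hv8 k hk
  rw [hv _ hk, hv _ (hpo'.mul hk), hv _ (hqo'.mul hk), hv _ (hpo'.mul (hqo'.mul hk)),
    hv _ (hqo'.mul (hpo'.mul hk)), hx', hy'] at hu
  refine ⟨a q * x - x + p * y - y - x + z, ?_⟩
  rw [h, hu]; push_cast; ring

/-- the rational congruences -/
lemma main (D : SymDat32 N a S) (p q : ℕ) (hp : p.Prime) (hpN : ¬ p ∣ N)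
    (hq : q.Prime) (hqN : ¬ q ∣ N) (hpq : p ≠ q) (hp4 : p % 4 = 3) (hq4 : q % 4 = 3)
    (hap : Odd (a p)) (haq : Odd (a q)) :
    ∃ c₁ c₂ c₃ c₄ : ℤ,
      (c₁ : ℚ) = 2 * (fS S (p * q) 32 5 - fS S (p * q) 32 11) ∧
      (c₂ : ℚ) = 2 * (fS S (p * q) 32 7 - fS S (p * q) 32 9) ∧
      (c₃ : ℚ) = 2 * (fS S (p * q) 32 3 - fS S (p * q) 32 13) ∧
      (c₄ : ℚ) = - 2 * (fS S (p * q) 32 1 - fS S (p * q) 32 15) ∧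
      (c₁ + c₄) % 4 = 0 ∧ (c₂ + c₃) % 4 = 0 ∧ (c₁ + c₂) % 4 = 2 ∧ (c₃ + c₄) % 4 = 2 := by
  have hpo : Odd p := Nat.odd_iff.2 (by omega)
  have hqo : Odd q := Nat.odd_iff.2 (by omega)
  have hm4 : (p * q) % 4 = 1 := by rw [Nat.mul_mod, hp4, hq4]
  have hm1 : 1 < p * q := by nlinarith [hp.two_le, hq.two_le]
  have hm0 : 0 < p * q := by omega
  have hmo : Odd (p * q) := hpo.mul hqo
  have hmN : Nat.Coprime (p * q) N := Nat.Coprime.mul_left ((Nat.Prime.coprime_iff_not_dvd hp).2 hpN)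
    ((Nat.Prime.coprime_iff_not_dvd hq).2 hqN)
  have c8 : ∀ n, Odd n → Nat.Coprime 8 n := fun n hn =>
    Nat.Coprime.pow_left 3 (Nat.coprime_two_left.2 hn)
  have c2 : ∀ n, Odd n → Nat.Coprime 2 n := fun n hn => Nat.coprime_two_left.2 hn
  obtain ⟨w1, h1, g1⟩ := D.w32 p q hp hpN hq hqN hpq hpo hqo hap haq 1 (by decide)
  obtain ⟨w5, h5, g5⟩ := D.w32 p q hp hpN hq hqN hpq hpo hqo hap haq 5 (by decide)
  obtain ⟨w7, h7, g7⟩ := D.w32 p q hp hpN hq hqN hpq hpo hqo hap haq 7 (by decide)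
  obtain ⟨w3, h3, g3⟩ := D.w32 p q hp hpN hq hqN hpq hpo hqo hap haq 3 (by decide)
  obtain ⟨x1, e1⟩ := D.g8 p q hp hpN hq hqN hpq hpo hqo 1 (by decide)
  obtain ⟨x5, e5⟩ := D.g8 p q hp hpN hq hqN hpq hpo hqo 5 (by decide)
  obtain ⟨z, hz, ez⟩ := D.h_even p q hp hpN hq hqN hpq hp4 hq4 hap haq
  have hc := SymDat.J_sum_even (p * q) hm4 hm1
  have t32 := fun k => D.f_two (p * q) 8 hmo (by norm_num) (c8 _ D.hN) hmN (c8 _ hmo) k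
  have t8 := D.f_two (p * q) 2 hmo (by norm_num) (c2 _ D.hN) hmN (c2 _ hmo) 1
  set c : ℤ := ∑ i ∈ range (p * q), jacobiSym i (p * q : ℕ)
  have e7 : fS S (p * q) 8 7 = x1 := by
    rw [← D.f_neg _ _ hm4 (by norm_num), ← e1, ← D.f_per _ _ hm0 (by norm_num) _ 1]; norm_num
  have e3 : fS S (p * q) 8 3 = x5 := by
    rw [← D.f_neg _ _ hm4 (by norm_num), ← e5, ← D.f_per _ _ hm0 (by norm_num) _ 1]; norm_num
  have f15 : fS S (p * q) 32 15 = fS S (p * q) 32 17 := by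
    rw [← D.f_neg _ _ hm4 (by norm_num), ← D.f_per _ _ hm0 (by norm_num) _ 1]; norm_num
  have f11 : fS S (p * q) 32 11 = fS S (p * q) 32 21 := by
    rw [← D.f_neg _ _ hm4 (by norm_num), ← D.f_per _ _ hm0 (by norm_num) _ 1]; norm_num
  have f9 : fS S (p * q) 32 9 = fS S (p * q) 32 23 := by
    rw [← D.f_neg _ _ hm4 (by norm_num), ← D.f_per _ _ hm0 (by norm_num) _ 1]; norm_num
  have f13 : fS S (p * q) 32 13 = fS S (p * q) 32 19 := by
    rw [← D.f_neg _ _ hm4 (by norm_num), ← D.f_per _ _ hm0 (by norm_num) _ 1]; norm_num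
  have k1 := t32 1
  have k5 := t32 5
  have k7 := t32 7
  have k3 := t32 3
  norm_num at k1 k5 k7 k3 t8
  have hsum : x1 + x5 = -c - z := by
    rw [e1, e5, ez] at t8
    exact_mod_cast t8
  obtain ⟨r1, r2, r3⟩ := nine_rel' p q hpo hqo
  have s1 : ((w1 - w5 : ℤ) : ZMod 2) = 0 := by push_cast at *; rw [g1, g5, r1, sub_self]
  have s2 : ((w7 - w3 : ℤ) : ZMod 2) = 0 := by push_cast at *; rw [g7, g3, r2, sub_self]
  have s3 : ((w1 - w7 - 1 : ℤ) : ZMod 2) = 0 := by push_cast at *; rw [g1, g7, r3]; ring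
  rw [ZMod.intCast_eq_zero_iff_even, Int.even_iff] at s1 s2 s3
  rw [Int.even_iff] at hc hz
  refine ⟨2 * w5 + 2 * c + 2 * x5, 2 * w7 + 2 * c + 2 * x1, 2 * w3 + 2 * c + 2 * x5,
    -(2 * w1 + 2 * c + 2 * x1), ?_, ?_, ?_, ?_, ?_, ?_, ?_, ?_⟩
  · push_cast; rw [f11]; linarith
  · push_cast; rw [f9]; linarith
  · push_cast; rw [f13]; linarith
  · push_cast; rw [f15]; linarith
  all_goals omega

end SymDat32

/-- extension of a character by zero -/
noncomputable def extZ {K : Type*} [Field K] {T : ℕ} (ψ : (ZMod T)ˣ →* K) (k : ZMod T) : K :=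
  open Classical in if h : IsUnit k then ψ h.unit else 0

lemma extZ_unit {K : Type*} [Field K] {T : ℕ} (ψ : (ZMod T)ˣ →* K) (u : (ZMod T)ˣ) :
    extZ ψ (u : ZMod T) = ψ u := by
  rw [extZ, dif_pos u.isUnit]
  congr 1
  ext; simp

lemma extZ_zero {K : Type*} [Field K] {T : ℕ} (ψ : (ZMod T)ˣ →* K) (k : ZMod T) (h : ¬ IsUnit k) :
    extZ ψ k = 0 := by
  rw [extZ, dif_neg h]

lemma Xi_eq (S : ℚ → ℚ) {K : Type*} [Field K] [CharZero K] (n m : ℕ)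
    [NeZero (2 ^ (n + 2) * m)] (ψ : (ZMod (2 ^ (n + 2)))ˣ →* K) :
    XiM S n m ψ = ∑ k ∈ range (2 ^ (n + 2)),
      extZ ψ (k : ZMod (2 ^ (n + 2))) * (fS S m (2 ^ (n + 2)) k : K) := by
  have hm : m ≠ 0 := by
    have := NeZero.ne (2 ^ (n + 2) * m)
    intro h; simp [h] at this
  have : NeZero m := ⟨hm⟩
  set P : ℤ → K := fun y => ((jacobiSym y m : ℤ) : K) * extZ ψ (y : ZMod (2 ^ (n + 2))) *
      (S ((y : ℚ) / (((2 ^ (n + 2)) * m : ℕ) : ℚ)) : K) with hP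
  have h1 : XiM S n m ψ = ∑ x : ZMod ((2 ^ (n + 2)) * m), P (x.val : ℤ) := by
    unfold XiM
    apply Fintype.sum_of_injective (fun u : (ZMod ((2 ^ (n + 2)) * m))ˣ => (u : ZMod ((2 ^ (n + 2)) * m))) Units.val_injective
    · intro x hx
      have hx' : ¬ IsUnit x := fun h => hx ⟨h.unit, by simp⟩
      have hx2 : ¬ Nat.Coprime x.val ((2 ^ (n + 2)) * m) := by
        rw [← ZMod.isUnit_iff_coprime]; simpa using hx'
      rw [Nat.coprime_mul_iff_right, not_and_or] at hx2
      simp only [hP]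
      rcases hx2 with h | h
      · rw [extZ_zero]
        · simp
        · rw [← ZMod.isUnit_iff_coprime] at h; simpa using h
      · have : jacobiSym (x.val : ℤ) m = 0 := by
          rw [jacobiSym.eq_zero_iff_not_coprime]; rw [Int.gcd_natCast_natCast]; exact h
        rw [this]; simp
    · intro u
      simp only [hP]
      congr 2
      rw [← extZ_unit]
      congr 1
      simp only [Units.coe_map, RingHom.toMonoidHom_eq_coe, MonoidHom.coe_coe, ZMod.castHom_apply, ZMod.cast_eq_val, Int.cast_natCast]
  rw [h1, ← aux_zsum ((2 ^ (n + 2)) * m) P, mul_comm (2 ^ (n + 2)) m, aux_mul' m (2 ^ (n + 2)) P]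
  apply Finset.sum_congr rfl
  intro k _
  rw [fS, Rat.cast_sum, Finset.mul_sum]
  apply Finset.sum_congr rfl
  intro i _
  simp only [hP]
  have e1 : ((2 ^ (n + 2) : ℕ) : ℤ) * i + k = k + (2 ^ (n + 2) : ℕ) * i := by ring
  have e2 : ((k + (2 ^ (n + 2) : ℕ) * i : ℤ) : ZMod (2 ^ (n + 2))) = (k : ZMod (2 ^ (n + 2))) := by rw [Int.cast_add, Int.cast_mul, Int.cast_natCast, Int.cast_natCast, ZMod.natCast_self]; simp
  rw [e1, e2]
  push_cast
  ring

lemma extZ_val {K : Type*} [Field K] (ζ : K) (ψ : (ZMod (2 ^ (3 + 2)))ˣ →* K)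
    (hψneg : ∀ u : (ZMod (2 ^ (3 + 2)))ˣ, (u : ZMod (2 ^ (3 + 2))) = -1 → ψ u = 1)
    (hψ5 : ∀ u : (ZMod (2 ^ (3 + 2)))ˣ, (u : ZMod (2 ^ (3 + 2))) = 5 → ψ u = ζ)
    (k : ZMod (2 ^ (3 + 2))) (j : ℕ) (h : k = 5 ^ j ∨ k = - 5 ^ j) : extZ ψ k = ζ ^ j := by
  set u : (ZMod (2 ^ (3 + 2)))ˣ := ⟨5, 13, by decide, by decide⟩ with hu
  have h5 : ψ u = ζ := hψ5 u rfl
  have h1 : ψ (-1) = 1 := hψneg (-1) (by simp)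
  rcases h with h | h
  · have e : k = ((u ^ j : (ZMod (2 ^ (3 + 2)))ˣ) : ZMod (2 ^ (3 + 2))) := by rw [h]; simp [hu]
    rw [e, extZ_unit, map_pow, h5]
  · have e : k = ((-1 * u ^ j : (ZMod (2 ^ (3 + 2)))ˣ) : ZMod (2 ^ (3 + 2))) := by rw [h]; simp [hu]
    rw [e, extZ_unit, map_mul, h1, map_pow, h5, one_mul]

end Helpers

/-- `Ξ_3(m)` lies in `ℤ[ζ_8]`, and writing `Ξ_3(m) = c₁ζ₈ + c₂ζ₈² + c₃ζ₈³ + c₄ζ₈⁴` with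
integers `cᵢ`, one has `c₁ + c₄ ≡ 0`, `c₂ + c₃ ≡ 0`, `c₁ + c₂ ≡ 2`, `c₃ + c₄ ≡ 2 (mod 4)`. -/
theorem coefficients_congruences_level_three
    (N : ℕ) (hN : Odd N)
    (a : ℕ → ℤ) (ha1 : a 1 = 1)
    (hamul : ∀ m k : ℕ, Nat.Coprime m k → a (m * k) = a m * a k)
    (S : ℚ → ℚ)
    (hS0 : S 0 = 0) (hSneg : ∀ β : ℚ, S (-β) = S β) (hSper : ∀ β : ℚ, S (β + 1) = S β)
    (hHecke : ∀ ℓ : ℕ, ℓ.Prime → ¬(ℓ ∣ N) → ∀ β : ℚ, Nat.Coprime β.den N →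
      ∑ x ∈ Finset.range ℓ, S ((β + (x : ℚ)) / (ℓ : ℚ)) =
        (a ℓ : ℚ) * S β - S ((ℓ : ℚ) * β) + ∑ x ∈ Finset.range ℓ, S ((x : ℚ) / (ℓ : ℚ)))
    (ha2 : a 2 = 0)
    (hhalf : ∀ β : ℚ, ∃ c : ℤ, S β = (c : ℚ) / 2)
    (hv2 : S (1 / 2) = -1) (hv4 : S (1 / 4) = -(1 / 2))
    (hv8 : ∀ x : ℤ, Odd x → S ((x : ℚ) / 8) = 0)
    (hv16a : S (1 / 16) = 0) (hv16b : S (5 / 16) = 0)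
    (hv16c : S (3 / 16) = -(1 / 2)) (hv16d : S (7 / 16) = -(1 / 2))
    (hv32a : S (3 / 32) = -(1 / 2)) (hv32b : S (7 / 32) = -(1 / 2))
    (hv32c : S (9 / 32) = -(1 / 2)) (hv32d : S (13 / 32) = -(1 / 2))
    (hv32e : S (11 / 32) = -1) (hv32f : S (15 / 32) = -1)
    (hv32g : S (1 / 32) = 0) (hv32h : S (5 / 32) = 0)
    (p q : ℕ) (hp : p.Prime) (hq : q.Prime) (hpq : p ≠ q)
    (hpN : ¬(p ∣ N)) (hqN : ¬(q ∣ N))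
    (hp12 : p % 12 = 7) (hq12 : q % 12 = 7)
    (hap : Odd (a p)) (haq : Odd (a q))
    [NeZero (2 ^ (3 + 2) * (p * q))]
    (K : Type*) [Field K] [Algebra ℚ_[2] K]
    (ζ : K) (hζ : IsPrimitiveRoot ζ 8)
    (ψ : (ZMod (2 ^ (3 + 2)))ˣ →* K)
    (hψneg : ∀ u : (ZMod (2 ^ (3 + 2)))ˣ, (u : ZMod (2 ^ (3 + 2))) = -1 → ψ u = 1)
    (hψ5 : ∀ u : (ZMod (2 ^ (3 + 2)))ˣ, (u : ZMod (2 ^ (3 + 2))) = 5 → ψ u = ζ) :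
    XiM S 3 (p * q) ψ ∈ Algebra.adjoin ℤ {ζ} ∧
      ∃ c₁ c₂ c₃ c₄ : ℤ,
        XiM S 3 (p * q) ψ =
            (c₁ : K) * ζ + (c₂ : K) * ζ ^ 2 + (c₃ : K) * ζ ^ 3 + (c₄ : K) * ζ ^ 4 ∧
          (c₁ + c₄) % 4 = 0 ∧ (c₂ + c₃) % 4 = 0 ∧ (c₁ + c₂) % 4 = 2 ∧ (c₃ + c₄) % 4 = 2 := by
  have : CharZero K := charZero_of_injective_algebraMap (algebraMap ℚ_[2] K).injective
  have D : SymDat32 N a S :=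
    { hN := hN, hS0 := hS0, hSneg := hSneg, hSper := hSper, hHecke := hHecke, ha2 := ha2,
      hhalf := hhalf, hv2 := hv2, hv8 := hv8, hv32a := hv32a, hv32b := hv32b, hv32c := hv32c,
      hv32d := hv32d, hv32e := hv32e, hv32f := hv32f, hv32g := hv32g, hv32h := hv32h }
  have hm4 : (p * q) % 4 = 1 := by
    rw [Nat.mul_mod, show p % 4 = 3 by omega, show q % 4 = 3 by omega]
  have hm0 : 0 < p * q := by omega
  obtain ⟨c₁, c₂, c₃, c₄, h1, h2, h3, h4, r1, r2, r3, r4⟩ :=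
    D.main p q hp hpN hq hqN hpq (by omega) (by omega) hap haq
  have hζ4 : ζ ^ 4 = -1 := by
    have h8 := hζ.pow_eq_one
    have hne := hζ.pow_ne_one_of_pos_of_lt (l := 4) (by norm_num) (by norm_num)
    have : (ζ ^ 4 - 1) * (ζ ^ 4 + 1) = 0 := by linear_combination h8
    rcases mul_eq_zero.1 this with h | h
    · exact absurd (sub_eq_zero.1 h) hne
    · linear_combination h
  have V := fun (k : ℕ) (j : ℕ) h => extZ_val ζ ψ hψneg hψ5 (k : ZMod (2 ^ (3 + 2))) j h
  have Z := fun (k : ℕ) (h : ¬ Nat.Coprime k (2 ^ (3 + 2))) =>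
    extZ_zero ψ (k : ZMod (2 ^ (3 + 2))) (by rw [ZMod.isUnit_iff_coprime]; exact h)
  have neg : ∀ k l : ℤ, k + l = 32 → fS S (p * q) (2 ^ (3 + 2)) k = fS S (p * q) (2 ^ (3 + 2)) l := by
    intro k l hkl
    rw [← D.f_neg _ _ hm4 (by norm_num) l, ← D.f_per _ _ hm0 (by norm_num) (-l) 1]
    congr 1; push_cast; linarith
  have hXi : XiM S 3 (p * q) ψ =
      (c₁ : K) * ζ + (c₂ : K) * ζ ^ 2 + (c₃ : K) * ζ ^ 3 + (c₄ : K) * ζ ^ 4 := by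
    have k1 := congrArg (Rat.cast : ℚ → K) h1
    have k2 := congrArg (Rat.cast : ℚ → K) h2
    have k3 := congrArg (Rat.cast : ℚ → K) h3
    have k4 := congrArg (Rat.cast : ℚ → K) h4
    push_cast at k1 k2 k3 k4
    rw [Xi_eq, k1, k2, k3, k4, show Finset.range (2 ^ (3 + 2)) = Finset.range 32 from rfl]
    simp only [Finset.sum_range_succ, Finset.sum_range_zero,
    V 1 0 (by decide),
    V 3 3 (by decide),
    V 5 1 (by decide),
    V 7 2 (by decide),
    V 9 6 (by decide),
    V 11 5 (by decide),
    V 13 7 (by decide),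
    V 15 4 (by decide),
    V 17 4 (by decide),
    V 19 7 (by decide),
    V 21 5 (by decide),
    V 23 6 (by decide),
    V 25 2 (by decide),
    V 27 1 (by decide),
    V 29 3 (by decide),
    V 31 0 (by decide),
    Z 0 (by decide),
    Z 2 (by decide),
    Z 4 (by decide),
    Z 6 (by decide),
    Z 8 (by decide),
    Z 10 (by decide),
    Z 12 (by decide),
    Z 14 (by decide),
    Z 16 (by decide),
    Z 18 (by decide),
    Z 20 (by decide),
    Z 22 (by decide),
    Z 24 (by decide),
    Z 26 (by decide),
    Z 28 (by decide),
    Z 30 (by decide)]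
    have n17 := neg 17 15 (by norm_num)
    have n19 := neg 19 13 (by norm_num)
    have n21 := neg 21 11 (by norm_num)
    have n23 := neg 23 9 (by norm_num)
    have n25 := neg 25 7 (by norm_num)
    have n27 := neg 27 5 (by norm_num)
    have n29 := neg 29 3 (by norm_num)
    have n31 := neg 31 1 (by norm_num)
    norm_num only at n17 n19 n21 n23 n25 n27 n29 n31
    norm_num only [Nat.cast_ofNat, Nat.cast_one, Nat.cast_zero, n17, n19, n21, n23, n25, n27, n29, n31]
    have h5 : ζ ^ 5 = -ζ := by linear_combination ζ * hζ4
    have h6 : ζ ^ 6 = -ζ ^ 2 := by linear_combination ζ ^ 2 * hζ4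
    have h7 : ζ ^ 7 = -ζ ^ 3 := by linear_combination ζ ^ 3 * hζ4
    rw [h5, h6, h7, hζ4]
    ring
  refine ⟨?_, c₁, c₂, c₃, c₄, hXi, r1, r2, r3, r4⟩
  have hmem : ζ ∈ Algebra.adjoin ℤ {ζ} := Algebra.subset_adjoin rfl
  have hInt : ∀ c : ℤ, (c : K) ∈ Algebra.adjoin ℤ {ζ} := fun c => by
    simpa using Subalgebra.algebraMap_mem (Algebra.adjoin ℤ {ζ}) c
  rw [hXi]
  exact add_mem (add_mem (add_mem (mul_mem (hInt _) hmem) (mul_mem (hInt _) (pow_mem hmem _)))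
    (mul_mem (hInt _) (pow_mem hmem _))) (mul_mem (hInt _) (pow_mem hmem _))
end
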